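/- For n₁, n₂ ≥ 2 and n = n₁ + n₂, the minimum wirelength of embedding the hypercube Q_n into the torus C_{2^{n₁}} × C_{2^{n₂}} (Cartesian product of two cycles) equals 2^{n₂}(3·2^{2n₁−3} − 2^{n₁−1}) + 2^{n₁}(3·2^{2n₂−3} − 2^{n₂−1}), and the 2-order Gray code embedding ξ_{n₁n₂} achieves this minimum. -/

import Mathlib

open Finset

/-- Number of coordinates in which two 0-1 vectors differ. -/
def diffCount {n : ℕ} (u v : Fin n → Bool) : ℕ :=
  (Finset.univ.filter fun i => u i ≠ v i).card

/-- Adjacency in the hypercube `Q_n`: differ in exactly one coordinate. -/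
def cubeAdj {n : ℕ} (u v : Fin n → Bool) : Prop := diffCount u v = 1

instance {n : ℕ} (u v : Fin n → Bool) : Decidable (cubeAdj u v) :=
  inferInstanceAs (Decidable (diffCount u v = 1))

/-- `theta n S`: number of edges of `Q_n` with exactly one endpoint in `S`. -/
def theta (n : ℕ) (S : Finset (Fin n → Bool)) : ℕ :=
  ((Finset.univ ×ˢ Finset.univ).filter fun p : (Fin n → Bool) × (Fin n → Bool) =>
    p.1 ∈ S ∧ p.2 ∉ S ∧ cubeAdj p.1 p.2).card

/-- The reflected Gray code map `ξ_n : {0,1}^n → {1,...,2^n}`. -/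
def gray : (n : ℕ) → (Fin n → Bool) → ℕ
  | 0, _ => 1
  | n + 1, v =>
    if v 0 = false then gray n (fun i => v i.succ)
    else 2 ^ (n + 1) + 1 - gray n (fun i => v i.succ)

/-- Wirelength of an embedding `f` of `Q_n` into a host with distance `d`. -/
def wirelength {n : ℕ} {α : Type*} (d : α → α → ℕ) (f : (Fin n → Bool) → α) : ℕ :=
  (∑ u : Fin n → Bool, ∑ v : Fin n → Bool, if cubeAdj u v then d (f u) (f v) else 0) / 2

/-- Cyclic distance on the cycle with `m` vertices labeled `1,...,m`. -/
def cycDist (m a b : ℕ) : ℕ := min (Nat.dist a b) (m - Nat.dist a b)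

/-- The 2-order Gray code map. -/
def gray2 (n₁ n₂ : ℕ) (v : Fin (n₁ + n₂) → Bool) : ℕ × ℕ :=
  (gray n₁ fun i => v (Fin.castAdd n₂ i), gray n₂ fun i => v (Fin.natAdd n₁ i))

/-- Graph distance in the torus `C_{m₁} × C_{m₂}` with vertices `{1,...,m₁} × {1,...,m₂}`. -/
def torusDist (m₁ m₂ : ℕ) (a b : ℕ × ℕ) : ℕ :=
  cycDist m₁ a.1 b.1 + cycDist m₂ a.2 b.2

/-! ### Splitting the hypercube along a coordinate -/

/-- Insert the bit `b` at coordinate `j`. -/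
def insertBit {n : ℕ} (j : Fin (n + 1)) (b : Bool) (u : Fin n → Bool) : Fin (n + 1) → Bool :=
  Fin.insertNth (α := fun _ => Bool) j b u

@[simp] lemma insertBit_same {n : ℕ} (j : Fin (n + 1)) (b : Bool) (u : Fin n → Bool) :
    insertBit j b u j = b := by
  simp [insertBit]

@[simp] lemma insertBit_succAbove {n : ℕ} (j : Fin (n + 1)) (b : Bool) (u : Fin n → Bool)
    (i : Fin n) : insertBit j b u (j.succAbove i) = u i := by
  simp [insertBit]

@[simp] lemma insertBit_zero_succ {n : ℕ} (b : Bool) (u : Fin n → Bool) (i : Fin n) :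
    insertBit 0 b u i.succ = u i := by
  simpa using insertBit_succAbove 0 b u i

lemma sum_insertBit {n : ℕ} {α : Type*} [AddCommMonoid α] (j : Fin (n + 1))
    (F : (Fin (n + 1) → Bool) → α) :
    ∑ w, F w = ∑ u, F (insertBit j false u) + ∑ u, F (insertBit j true u) := by
  rw [← Equiv.sum_comp (Fin.insertNthEquiv (fun _ => Bool) j), Fintype.sum_prod_type,
    Fintype.sum_bool, add_comm]
  rfl

lemma diffCount_eq_sum {n : ℕ} (u v : Fin n → Bool) :
    diffCount u v = ∑ i, if u i ≠ v i then 1 else 0 := by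
  simp only [diffCount, Finset.card_filter]

lemma diffCount_insertBit {n : ℕ} (j : Fin (n + 1)) (b c : Bool) (u v : Fin n → Bool) :
    diffCount (insertBit j b u) (insertBit j c v) = (if b ≠ c then 1 else 0) + diffCount u v := by
  simp only [diffCount_eq_sum, Fin.sum_univ_succAbove _ j, insertBit_same, insertBit_succAbove]

lemma diffCount_eq_zero {n : ℕ} {u v : Fin n → Bool} : diffCount u v = 0 ↔ u = v := by
  simp [diffCount, Finset.filter_eq_empty_iff, funext_iff]

/-- Sum of `F` over the ordered pairs of adjacent vertices of `Q_n`. -/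
def edgeSum {n : ℕ} {α : Type*} [AddCommMonoid α] (F : (Fin n → Bool) → (Fin n → Bool) → α) : α :=
  ∑ u, ∑ v, if cubeAdj u v then F u v else 0

lemma edgeSum_insertBit {n : ℕ} {α : Type*} [AddCommMonoid α] (j : Fin (n + 1))
    (F : (Fin (n + 1) → Bool) → (Fin (n + 1) → Bool) → α) :
    edgeSum F = edgeSum (fun u v => F (insertBit j false u) (insertBit j false v)) +
      edgeSum (fun u v => F (insertBit j true u) (insertBit j true v)) +
      ∑ u, (F (insertBit j false u) (insertBit j true u) +
        F (insertBit j true u) (insertBit j false u)) := by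
  have same : ∀ b (u v : Fin n → Bool),
      cubeAdj (insertBit j b u) (insertBit j b v) ↔ cubeAdj u v := by
    intro b u v
    simp [cubeAdj, diffCount_insertBit]
  have cross : ∀ b c (u v : Fin n → Bool), b ≠ c →
      (cubeAdj (insertBit j b u) (insertBit j c v) ↔ u = v) := by
    intro b c u v h
    simp [cubeAdj, diffCount_insertBit, h, diffCount_eq_zero]
  unfold edgeSum
  simp only [sum_insertBit j, same, cross false true _ _ (by simp), cross true false _ _ (by simp),
    Finset.sum_add_distrib, Finset.sum_ite_eq, Finset.mem_univ, if_true]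
  abel

lemma edgeSum_mono {n : ℕ} {F G : (Fin n → Bool) → (Fin n → Bool) → ℤ}
    (h : ∀ u v, F u v ≤ G u v) : edgeSum F ≤ edgeSum G := by
  unfold edgeSum
  gcongr with u _ v _
  split_ifs
  · exact h u v
  · exact le_rfl

lemma edgeSum_add {n : ℕ} {α : Type*} [AddCommMonoid α]
    (F G : (Fin n → Bool) → (Fin n → Bool) → α) :
    edgeSum (fun u v => F u v + G u v) = edgeSum F + edgeSum G := by
  simp only [edgeSum, ← Finset.sum_add_distrib]
  refine Finset.sum_congr rfl fun u _ => Finset.sum_congr rfl fun v _ => ?_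
  split_ifs <;> simp

lemma edgeSum_mul_left {n : ℕ} (c : ℤ) (F : (Fin n → Bool) → (Fin n → Bool) → ℤ) :
    edgeSum (fun u v => c * F u v) = c * edgeSum F := by
  simp only [edgeSum, Finset.mul_sum, mul_ite, mul_zero]

lemma edgeSum_sum {n : ℕ} {ι : Type*} (s : Finset ι)
    (F : ι → (Fin n → Bool) → (Fin n → Bool) → ℤ) :
    edgeSum (fun u v => ∑ i ∈ s, F i u v) = ∑ i ∈ s, edgeSum (F i) := by
  symm
  simp only [edgeSum]
  rw [Finset.sum_comm]
  refine Finset.sum_congr rfl fun u _ => ?_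
  rw [Finset.sum_comm]
  refine Finset.sum_congr rfl fun v _ => ?_
  split_ifs <;> simp

lemma edgeSum_zero_dim {α : Type*} [AddCommMonoid α]
    (F : (Fin 0 → Bool) → (Fin 0 → Bool) → α) : edgeSum F = 0 := by
  simp [edgeSum, cubeAdj, diffCount]

/-! ### The edge-isoperimetric function -/

/-- The `2^r`-periodic Takagi-type function: on `[0, 2^r]` it is the minimal edge boundary of a
set of `x` vertices of `Q_r`. -/
def isoBound : ℕ → ℤ → ℤ
  | 0, _ => 0
  | r + 1, x => isoBound r (x / 2) + isoBound r ((x + 1) / 2) + x % 2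

lemma isoBound_succ_eq (r : ℕ) (x : ℤ) :
    isoBound (r + 1) x = isoBound r (x / 2) + isoBound r ((x + 1) / 2) + x % 2 :=
  rfl

lemma isoBound_nonneg (r : ℕ) (x : ℤ) : 0 ≤ isoBound r x := by
  induction r generalizing x with
  | zero => simp [isoBound]
  | succ r ih =>
    have := ih (x / 2)
    have := ih ((x + 1) / 2)
    simp only [isoBound]
    omega

lemma isoBound_neg (r : ℕ) (x : ℤ) : isoBound r (-x) = isoBound r x := by
  induction r generalizing x with
  | zero => simp [isoBound]
  | succ r ih =>
    have h1 : -x / 2 = -((x + 1) / 2) := by omega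
    have h2 : (-x + 1) / 2 = -(x / 2) := by omega
    have h3 : -x % 2 = x % 2 := by omega
    simp only [isoBound, h1, h2, h3, ih]
    ring

lemma isoBound_add_pow (r : ℕ) (x : ℤ) : isoBound r (x + 2 ^ r) = isoBound r x := by
  induction r generalizing x with
  | zero => simp [isoBound]
  | succ r ih =>
    have h1 : (x + 2 ^ (r + 1)) / 2 = x / 2 + 2 ^ r := by omega
    have h2 : (x + 2 ^ (r + 1) + 1) / 2 = (x + 1) / 2 + 2 ^ r := by omega
    have h3 : (x + 2 ^ (r + 1)) % 2 = x % 2 := by omega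
    simp only [isoBound, h1, h2, h3, ih]

lemma isoBound_pow_sub (r : ℕ) (x : ℤ) : isoBound r (2 ^ r - x) = isoBound r x := by
  rw [sub_eq_neg_add, isoBound_add_pow, isoBound_neg]

lemma isoBound_abs (r : ℕ) (x : ℤ) : isoBound r |x| = isoBound r x := by
  rcases abs_choice x with h | h <;> rw [h]
  exact isoBound_neg r x

lemma isoBound_succ {r : ℕ} {x : ℤ} (h0 : 0 ≤ x) (h1 : x ≤ 2 ^ r) :
    isoBound (r + 1) x = isoBound r x + x := by
  induction r generalizing x with
  | zero =>
    simp only [isoBound]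
    omega
  | succ r ih =>
    rw [isoBound, ih (x := x / 2) (by omega) (by omega),
      ih (x := (x + 1) / 2) (by omega) (by omega), isoBound]
    omega

lemma isoBound_add_le (r : ℕ) (a b : ℤ) :
    isoBound (r + 1) (a + b) ≤ isoBound r a + isoBound r b + |a - b| := by
  induction r generalizing a b with
  | zero =>
    simp only [isoBound]
    rcases abs_cases (a - b) with h | h <;> omega
  | succ r ih =>
    have h1 := ih (a / 2) (b / 2)
    have h2 := ih ((a + 1) / 2) ((b + 1) / 2)
    have h3 := ih (a / 2) ((b + 1) / 2)
    have h4 := ih ((a + 1) / 2) (b / 2)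
    have hab : |a - b| = max (a - b) (b - a) := by rw [← neg_sub a b]; rfl
    rw [isoBound_succ_eq (r + 1), isoBound_succ_eq r a, isoBound_succ_eq r b]
    simp only [abs_eq_max_neg] at h1 h2 h3 h4
    obtain ⟨c, rfl | rfl⟩ := Int.even_or_odd' a <;>
      obtain ⟨d, rfl | rfl⟩ := Int.even_or_odd' b
    · have e1 : (2 * c + 2 * d) / 2 = 2 * c / 2 + 2 * d / 2 := by omega
      have e2 : (2 * c + 2 * d + 1) / 2 = (2 * c + 1) / 2 + (2 * d + 1) / 2 := by omega
      rw [e1, e2]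
      omega
    · have e1 : (2 * c + (2 * d + 1)) / 2 = 2 * c / 2 + (2 * d + 1) / 2 := by omega
      have e2 : (2 * c + (2 * d + 1) + 1) / 2 = (2 * c + 1) / 2 + (2 * d + 1 + 1) / 2 := by omega
      rw [e1, e2]
      omega
    · have e1 : (2 * c + 1 + 2 * d) / 2 = (2 * c + 1) / 2 + 2 * d / 2 := by omega
      have e2 : (2 * c + 1 + 2 * d + 1) / 2 = (2 * c + 1 + 1) / 2 + (2 * d + 1) / 2 := by omega
      rw [e1, e2]
      omega
    · have e1 : (2 * c + 1 + (2 * d + 1)) / 2 = (2 * c + 1) / 2 + (2 * d + 1 + 1) / 2 := by omega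
      have e2 : (2 * c + 1 + (2 * d + 1) + 1) / 2 = (2 * c + 1 + 1) / 2 + (2 * d + 1) / 2 := by
        omega
      rw [e1, e2]
      omega

lemma pow_le_isoBound {r : ℕ} {y : ℤ} (h0 : 2 ^ r ≤ y) (h1 : y ≤ 3 * 2 ^ r) :
    2 ^ (r + 1) ≤ isoBound (r + 2) y := by
  have lower : ∀ y : ℤ, 2 ^ r ≤ y → y ≤ 2 ^ (r + 1) → 2 ^ (r + 1) ≤ isoBound (r + 2) y := by
    intro y h0 h1
    have hpos : (0 : ℤ) < 2 ^ r := by positivity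
    rw [isoBound_succ (by omega) h1, ← isoBound_pow_sub, isoBound_succ (by omega) (by omega)]
    have := isoBound_nonneg r (2 ^ (r + 1) - y)
    omega
  rcases le_total y (2 ^ (r + 1)) with h | h
  · exact lower y h0 h
  · have h4 : (2 : ℤ) ^ (r + 2) = 4 * 2 ^ r := by ring
    have h5 : (2 : ℤ) ^ (r + 1) = 2 * 2 ^ r := by ring
    rw [← isoBound_pow_sub]
    exact lower _ (by omega) (by omega)

/-- Twice the trapezoidal sum of `isoBound r` over `[0, x]`. -/
def isoTrap (r x : ℕ) : ℤ := ∑ p ∈ Finset.range x, (isoBound r p + isoBound r (p + 1))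

lemma isoTrap_zero (r : ℕ) : isoTrap r 0 = 0 := by simp [isoTrap]

lemma isoTrap_succ_right (r x : ℕ) :
    isoTrap r (x + 1) = isoTrap r x + (isoBound r x + isoBound r (x + 1)) := by
  simp [isoTrap, Finset.sum_range_succ]

lemma isoTrap_succ_left {r x : ℕ} (h : x ≤ 2 ^ r) : isoTrap (r + 1) x = isoTrap r x + x ^ 2 := by
  induction x with
  | zero => simp [isoTrap_zero]
  | succ x ih =>
    have hx : (x : ℤ) + 1 ≤ 2 ^ r := by exact_mod_cast h
    rw [isoTrap_succ_right, isoTrap_succ_right, ih (by omega),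
      isoBound_succ (by omega) (by omega), isoBound_succ (by omega) hx]
    push_cast
    ring

lemma isoTrap_add_isoTrap {r m x : ℕ} (h : m + x = 2 ^ r) :
    isoTrap r m + isoTrap r x = isoTrap r (2 ^ r) := by
  induction x generalizing m with
  | zero => simp [isoTrap_zero, ← h]
  | succ x ih =>
    have hz : (m : ℤ) + (x + 1) = 2 ^ r := by exact_mod_cast h
    rw [← ih (m := m + 1) (by omega), isoTrap_succ_right, isoTrap_succ_right,
      ← isoBound_pow_sub r x, ← isoBound_pow_sub r (x + 1),
      show (2 : ℤ) ^ r - x = m + 1 by omega, show (2 : ℤ) ^ r - (x + 1) = m by omega]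
    ring

lemma isoTrap_pow (r : ℕ) : isoTrap r (2 ^ r) = 2 ^ r * (2 ^ r - 1) := by
  induction r with
  | zero => simp [isoTrap, isoBound]
  | succ r ih =>
    rw [← isoTrap_add_isoTrap (m := 2 ^ r) (x := 2 ^ r) (by ring), isoTrap_succ_left le_rfl, ih]
    push_cast
    ring

lemma isoTrap_le_mul_pow {r x : ℕ} (h : x ≤ 2 ^ r) : isoTrap (r + 1) x ≤ x * 2 ^ (r + 1) := by
  induction r generalizing x with
  | zero =>
    obtain rfl | rfl : x = 0 ∨ x = 1 := by simp at h; omega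
    · simp [isoTrap_zero]
    · simp [isoTrap, isoBound]
  | succ r ih =>
    rcases le_total x (2 ^ r) with hx | hx
    · rw [isoTrap_succ_left h]
      have h1 := ih hx
      have h2 : (x : ℤ) ≤ 2 ^ r := by exact_mod_cast hx
      have h3 : (2 : ℤ) ^ (r + 2) = 4 * 2 ^ r := by ring
      have h4 : (2 : ℤ) ^ (r + 1) = 2 * 2 ^ r := by ring
      rw [h3]
      rw [h4] at h1
      nlinarith
    · have tail : ∀ d, ∀ x : ℕ, 2 ^ r ≤ x → x + d = 2 ^ (r + 1) →
          isoTrap (r + 2) x + d * 2 ^ (r + 2) ≤ isoTrap (r + 2) (2 ^ (r + 1)) := by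
        intro d
        induction d with
        | zero =>
          intro x _ hd
          simp [← hd]
        | succ d ihd =>
          intro x hx hd
          have h1 := ihd (x + 1) (by omega) (by omega)
          have hx' : (2 : ℤ) ^ r ≤ x := by exact_mod_cast hx
          have hd' : (x : ℤ) + (d + 1) = 2 ^ (r + 1) := by exact_mod_cast hd
          have h2 := pow_le_isoBound (r := r) (y := x) hx' (by omega)
          have h3 := pow_le_isoBound (r := r) (y := x + 1) (by omega) (by omega)
          rw [isoTrap_succ_right] at h1
          have h4 : (2 : ℤ) ^ (r + 2) = 2 * 2 ^ (r + 1) := by ring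
          push_cast
          rw [h4] at h1 ⊢
          linarith
      obtain ⟨d, hd⟩ := Nat.exists_eq_add_of_le h
      have h1 := tail d x hx hd.symm
      rw [isoTrap_succ_left le_rfl, isoTrap_pow] at h1
      have hd' : (2 : ℤ) ^ (r + 1) = x + d := by exact_mod_cast hd
      have h4 : (2 : ℤ) ^ (r + 2) = 2 * 2 ^ (r + 1) := by ring
      push_cast at h1
      rw [show r + 1 + 1 = r + 2 from rfl, h4] at *
      have : (0 : ℤ) < 2 ^ (r + 1) := by positivity
      nlinarith

lemma isoTrap_le_mul_isoBound {r x y : ℕ} (hxy : x ≤ y) (h : x + y ≤ 2 ^ r) :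
    isoTrap r x ≤ 2 * x * isoBound r y := by
  induction r generalizing x y with
  | zero =>
    obtain rfl : x = 0 := by simp at h; omega
    simp [isoTrap_zero]
  | succ r ih =>
    have lower : ∀ y : ℕ, x ≤ y → y ≤ 2 ^ r →
        isoTrap (r + 1) x ≤ 2 * x * isoBound (r + 1) y := by
      intro y hxy hy
      have hxyz : (x : ℤ) ≤ y := by exact_mod_cast hxy
      by_cases hs : x + y ≤ 2 ^ r
      · rw [isoTrap_succ_left (by omega), isoBound_succ (by omega) (by exact_mod_cast hy)]
        have := ih hxy hs
        nlinarith
      · rcases r with _ | r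
        · obtain rfl : x = 1 := by simp at *; omega
          obtain rfl : y = 1 := by simp at *; omega
          simp [isoTrap, isoBound]
        · have h1 := isoTrap_le_mul_pow (r := r + 1) (x := x) (by omega)
          have hs' : (2 : ℤ) ^ (r + 1) < x + y := by exact_mod_cast not_le.mp hs
          have hy' : (y : ℤ) ≤ 2 ^ (r + 1) := by exact_mod_cast hy
          have h2 := pow_le_isoBound (r := r) (y := y) (by omega) (by omega)
          have h4 : (2 : ℤ) ^ (r + 1 + 1) = 2 * 2 ^ (r + 1) := by ring
          rw [h4] at h1
          nlinarith
    rcases le_total y (2 ^ r) with hy | hy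
    · exact lower y hxy hy
    · have h1 := lower (2 ^ (r + 1) - y) (by omega) (by omega)
      rw [Nat.cast_sub (by omega)] at h1
      push_cast at h1
      rwa [isoBound_pow_sub] at h1

/-! ### Dirichlet energy on the hypercube -/

/-- The sum of `(s u - s v) ^ 2` over ordered pairs of adjacent vertices. -/
def energy {n : ℕ} (s : (Fin n → Bool) → ℤ) : ℤ := edgeSum fun u v => (s u - s v) ^ 2

/-- The unnormalized first-level Fourier coefficient in direction `j`. -/
def coordSum {n : ℕ} (s : (Fin n → Bool) → ℤ) (j : Fin n) : ℤ :=
  ∑ v, if v j then s v else -s v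

lemma energy_nonneg {n : ℕ} (s : (Fin n → Bool) → ℤ) : 0 ≤ energy s :=
  Finset.sum_nonneg fun u _ => Finset.sum_nonneg fun v _ => by split_ifs <;> positivity

lemma energy_insertBit {n : ℕ} (j : Fin (n + 1)) (s : (Fin (n + 1) → Bool) → ℤ) :
    energy s = energy (fun u => s (insertBit j false u)) +
      energy (fun u => s (insertBit j true u)) +
      2 * ∑ u, (s (insertBit j false u) - s (insertBit j true u)) ^ 2 := by
  unfold energy
  rw [edgeSum_insertBit j, Finset.mul_sum]
  congr 1
  exact Finset.sum_congr rfl fun u _ => by ring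

lemma energy_add_energy {n : ℕ} (a b : (Fin n → Bool) → ℤ) :
    2 * (energy a + energy b) = energy (fun u => a u + b u) + energy (fun u => a u - b u) := by
  unfold energy
  rw [← edgeSum_add, ← edgeSum_add, ← edgeSum_mul_left]
  congr 1
  funext u v
  ring

lemma coordSum_insertBit_same {n : ℕ} (j : Fin (n + 1)) (s : (Fin (n + 1) → Bool) → ℤ) :
    coordSum s j = ∑ u, s (insertBit j true u) - ∑ u, s (insertBit j false u) := by
  simp only [coordSum, sum_insertBit j, insertBit_same]
  simp
  ring

lemma coordSum_insertBit_zero_succ {n : ℕ} (j : Fin n) (s : (Fin (n + 1) → Bool) → ℤ) :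
    coordSum s j.succ = coordSum (fun u => s (insertBit 0 false u)) j +
      coordSum (fun u => s (insertBit 0 true u)) j := by
  simp only [coordSum, sum_insertBit 0, insertBit_zero_succ]

lemma coordSum_add {n : ℕ} (a b : (Fin n → Bool) → ℤ) (j : Fin n) :
    coordSum (fun u => a u + b u) j = coordSum a j + coordSum b j := by
  simp only [coordSum, ← Finset.sum_add_distrib]
  refine Finset.sum_congr rfl fun u _ => ?_
  split_ifs <;> ring

lemma int_abs_le_sq (x : ℤ) : |x| ≤ x ^ 2 := by
  rw [← sq_abs]
  exact Int.le_self_sq |x|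

lemma abs_sum_sub_sum_le {ι : Type*} (t : Finset ι) (a b : ι → ℤ) :
    |∑ i ∈ t, a i - ∑ i ∈ t, b i| ≤ ∑ i ∈ t, (a i - b i) ^ 2 := by
  rw [← Finset.sum_sub_distrib]
  exact (Finset.abs_sum_le_sum_abs _ _).trans
    (Finset.sum_le_sum fun i _ => int_abs_le_sq _)

/-- Harper's edge-isoperimetric inequality. -/
lemma two_mul_isoBound_le_energy {n : ℕ} (s : (Fin n → Bool) → ℤ) :
    2 * isoBound n (∑ v, s v) ≤ energy s := by
  induction n with
  | zero => simpa [isoBound] using energy_nonneg s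
  | succ n ih =>
    rw [energy_insertBit 0, sum_insertBit 0]
    have h0 := ih fun u => s (insertBit 0 false u)
    have h1 := ih fun u => s (insertBit 0 true u)
    have h2 := isoBound_add_le n (∑ u, s (insertBit 0 false u)) (∑ u, s (insertBit 0 true u))
    have h3 := abs_sum_sub_sum_le Finset.univ (fun u => s (insertBit 0 false u))
      (fun u => s (insertBit 0 true u))
    linarith

lemma sum_abs_coordSum_le_energy {n : ℕ} (s : (Fin n → Bool) → ℤ) :
    2 * ∑ j, |coordSum s j| ≤ energy s := by
  induction n with
  | zero => simpa using energy_nonneg s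
  | succ n ih =>
    rw [energy_insertBit 0, Fin.sum_univ_succ, coordSum_insertBit_same, abs_sub_comm]
    have h0 := ih fun u => s (insertBit 0 false u)
    have h1 := ih fun u => s (insertBit 0 true u)
    have h2 : ∑ j : Fin n, |coordSum s j.succ| ≤
        ∑ j, |coordSum (fun u => s (insertBit 0 false u)) j| +
          ∑ j, |coordSum (fun u => s (insertBit 0 true u)) j| := by
      rw [← Finset.sum_add_distrib]
      refine Finset.sum_le_sum fun j _ => ?_
      rw [coordSum_insertBit_zero_succ]
      exact abs_add_le _ _
    have h3 := abs_sum_sub_sum_le Finset.univ (fun u => s (insertBit 0 false u))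
      (fun u => s (insertBit 0 true u))
    linarith

lemma two_mul_sum_sq_add_sum_sq {ι : Type*} (t : Finset ι) (a b : ι → ℤ) :
    2 * (∑ i ∈ t, a i ^ 2 + ∑ i ∈ t, b i ^ 2) =
      ∑ i ∈ t, (a i + b i) ^ 2 + ∑ i ∈ t, (a i - b i) ^ 2 := by
  rw [← Finset.sum_add_distrib, ← Finset.sum_add_distrib, Finset.mul_sum]
  exact Finset.sum_congr rfl fun i _ => by ring

/-- The Poincaré inequality on the hypercube. -/
lemma poincare {n : ℕ} (s : (Fin n → Bool) → ℤ) :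
    4 * 2 ^ n * ∑ v, s v ^ 2 ≤ 2 ^ n * energy s + 4 * (∑ v, s v) ^ 2 := by
  induction n with
  | zero => simpa using energy_nonneg s
  | succ n ih =>
    rw [energy_insertBit 0, sum_insertBit 0, sum_insertBit 0]
    have h0 := ih fun u => s (insertBit 0 false u) + s (insertBit 0 true u)
    have h1 := mul_le_mul_of_nonneg_left (energy_nonneg fun u =>
      s (insertBit 0 false u) - s (insertBit 0 true u)) (by positivity : (0 : ℤ) ≤ 2 ^ n)
    have h2 := congrArg ((2 : ℤ) ^ n * ·) (energy_add_energy
      (fun u => s (insertBit 0 false u)) (fun u => s (insertBit 0 true u)))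
    have h3 := congrArg ((2 : ℤ) ^ n * ·) (two_mul_sum_sq_add_sum_sq Finset.univ
      (fun u => s (insertBit 0 false u)) (fun u => s (insertBit 0 true u)))
    rw [Finset.sum_add_distrib] at h0
    simp only [pow_succ (2 : ℤ) n] at *
    linarith

/-- The second-level spectral inequality on the hypercube. -/
lemma spectral {n : ℕ} (s : (Fin n → Bool) → ℤ) :
    8 * 2 ^ n * ∑ v, s v ^ 2 ≤
      2 ^ n * energy s + 4 * ∑ j, coordSum s j ^ 2 + 8 * (∑ v, s v) ^ 2 := by
  induction n with
  | zero =>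
    have := energy_nonneg s
    simp
    linarith
  | succ n ih =>
    rw [energy_insertBit 0, sum_insertBit 0, sum_insertBit 0, Fin.sum_univ_succ,
      coordSum_insertBit_same]
    have h0 := ih fun u => s (insertBit 0 false u) + s (insertBit 0 true u)
    have h1 := poincare fun u => s (insertBit 0 false u) - s (insertBit 0 true u)
    have h2 := congrArg ((2 : ℤ) ^ n * ·) (energy_add_energy
      (fun u => s (insertBit 0 false u)) (fun u => s (insertBit 0 true u)))
    have h3 := congrArg ((2 : ℤ) ^ n * ·) (two_mul_sum_sq_add_sum_sq Finset.univ
      (fun u => s (insertBit 0 false u)) (fun u => s (insertBit 0 true u)))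
    rw [Finset.sum_add_distrib] at h0
    rw [Finset.sum_sub_distrib] at h1
    simp only [coordSum_insertBit_zero_succ, ← coordSum_add]
    simp only [pow_succ (2 : ℤ) n] at *
    linarith

/-! ### Sets containing half of the vertices -/

lemma coordSum_eq {n : ℕ} (s : (Fin n → Bool) → ℤ) (j : Fin n) :
    coordSum s j = 2 * (∑ v, if v j then s v else 0) - ∑ v, s v := by
  rw [coordSum, Finset.mul_sum, ← Finset.sum_sub_distrib]
  refine Finset.sum_congr rfl fun v _ => ?_
  split_ifs <;> ring

lemma energy_ge_of_coord {r : ℕ} {s : (Fin (r + 2) → Bool) → ℤ} (hs : ∑ v, s v = 2 * 2 ^ r)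
    {j : Fin (r + 2)} {q : ℤ} (hq : ∑ v, (if v j then s v else 0) = 2 ^ r + q)
    (hq' : |q| ≤ 2 ^ r) : 4 * 2 ^ r + 4 * isoBound r q ≤ energy s := by
  have ht : ∑ u, s (insertBit j true u) = 2 ^ r + q := by
    rw [← hq, sum_insertBit j]
    simp
  have hf : ∑ u, s (insertBit j false u) = 2 ^ r - q := by
    rw [sum_insertBit j] at hs
    linarith
  have key : isoBound (r + 1) (2 ^ r - q) = 2 ^ r - |q| + isoBound r q := by
    have h1 : isoBound (r + 1) (2 ^ r - q) = isoBound (r + 1) (2 ^ r - |q|) := by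
      rcases abs_choice q with h | h <;> rw [h]
      rw [← isoBound_pow_sub]
      congr 1
      ring
    rw [h1, isoBound_succ (by linarith) (by linarith [abs_nonneg q]), isoBound_pow_sub,
      isoBound_abs]
    ring
  have key' : isoBound (r + 1) (2 ^ r + q) = 2 ^ r - |q| + isoBound r q := by
    rw [← key, ← isoBound_pow_sub]
    congr 1
    ring
  rw [energy_insertBit j]
  have h0 := two_mul_isoBound_le_energy fun u => s (insertBit j false u)
  have h1 := two_mul_isoBound_le_energy fun u => s (insertBit j true u)
  have h3 := abs_sum_sub_sum_le Finset.univ (fun u => s (insertBit j true u))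
    (fun u => s (insertBit j false u))
  rw [hf, key] at h0
  rw [ht, key'] at h1
  rw [ht, hf, show (2 : ℤ) ^ r + q - (2 ^ r - q) = 2 * q by ring, abs_mul, abs_two] at h3
  simp only [sub_sq_comm (s (insertBit j true _))] at h3
  linarith

lemma energy_ge_of_balanced {r : ℕ} {s : (Fin (r + 2) → Bool) → ℤ}
    (hs : ∑ v, s v = 2 * 2 ^ r) (h01 : ∀ v, s v = 0 ∨ s v = 1)
    (hb : ∀ j, 2 * |coordSum s j| ≤ 2 ^ r) : 6 * 2 ^ r ≤ energy s := by
  have h1 := spectral fun v => 2 * s v - 1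
  have h2 : ∀ v, (2 * s v - 1) ^ 2 = 1 := fun v => by
    rcases h01 v with h | h <;> rw [h] <;> norm_num
  have h3 : energy (fun v => 2 * s v - 1) = 4 * energy s := by
    unfold energy
    rw [← edgeSum_mul_left]
    congr 1
    funext u v
    ring
  have h4 : ∑ v, (2 * s v - 1) = 0 := by
    rw [Finset.sum_sub_distrib, ← Finset.mul_sum, hs]
    simp
    ring
  have hone : ∀ j, coordSum (fun _ : Fin (r + 2) → Bool => (-1 : ℤ)) j = 0 := fun j => by
    rw [coordSum_insertBit_same]
    simp
  have h5 : ∀ j, coordSum (fun v => 2 * s v - 1) j = 2 * coordSum s j := fun j => by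
    have : (fun v => 2 * s v - 1) = fun v => (s v + s v) + (-1) := by
      funext v
      ring
    rw [this, coordSum_add, coordSum_add, hone]
    ring
  simp only [h2, h3, h4, h5] at h1
  have h6 : ∑ j, 2 * coordSum s j ^ 2 ≤ ∑ j, 2 ^ r * |coordSum s j| := by
    refine Finset.sum_le_sum fun j _ => ?_
    rw [← sq_abs]
    nlinarith [hb j, abs_nonneg (coordSum s j)]
  have h7 := sum_abs_coordSum_le_energy s
  rw [← Finset.mul_sum, ← Finset.mul_sum] at h6
  simp only [mul_pow, ← Finset.mul_sum] at h1
  have hK : (0 : ℤ) < 2 ^ r := by positivity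
  simp only [Finset.sum_const, Finset.card_univ, Fintype.card_pi, Fintype.card_bool,
    Finset.prod_const, Fintype.card_fin, pow_add] at h1
  push_cast at h1
  have h8 : (2 : ℤ) ^ r * (2 * ∑ j, |coordSum s j|) ≤ 2 ^ r * energy s := by gcongr
  have h9 : 0 ≤ (2 : ℤ) ^ r * (5 * energy s - 32 * 2 ^ r) := by
    simp at h1
    nlinarith
  have := nonneg_of_mul_nonneg_right h9 hK
  linarith

/-! ### Half-circle indicators -/

/-- Indicator of the first half of a cycle of length `2 * M`. -/
def halfInd (M i : ℕ) : ℤ := if i % (2 * M) < M then 1 else 0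

lemma halfInd_eq_zero_or_one (M i : ℕ) : halfInd M i = 0 ∨ halfInd M i = 1 := by
  unfold halfInd
  split_ifs <;> simp

lemma halfInd_add_half {M : ℕ} (hM : 0 < M) (i : ℕ) : halfInd M (i + M) = 1 - halfInd M i := by
  have h1 := Nat.div_add_mod i (2 * M)
  have h2 := Nat.mod_lt i (show 0 < 2 * M by omega)
  unfold halfInd
  by_cases h : i % (2 * M) < M
  · have h3 : (i + M) % (2 * M) = i % (2 * M) + M := by
      conv_lhs => rw [← h1, add_assoc, Nat.mul_add_mod, Nat.mod_eq_of_lt (by omega)]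
    rw [if_pos h, h3, if_neg (by omega)]
    rfl
  · have h3 : (i + M) % (2 * M) = i % (2 * M) - M := by
      conv_lhs =>
        rw [← h1, add_assoc, Nat.mul_add_mod,
          show i % (2 * M) + M = i % (2 * M) - M + 2 * M by omega, Nat.add_mod_right,
          Nat.mod_eq_of_lt (by omega)]
    rw [if_neg h, h3, if_pos (by omega)]
    rfl

lemma halfInd_add_period (M i : ℕ) : halfInd M (i + 2 * M) = halfInd M i := by
  simp [halfInd]

lemma halfInd_of_lt {M i : ℕ} (h : i < M) : halfInd M i = 1 := by
  rw [halfInd, Nat.mod_eq_of_lt (by omega), if_pos h]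

lemma halfInd_of_ge {M i : ℕ} (h : M ≤ i) (h' : i < 2 * M) : halfInd M i = 0 := by
  rw [halfInd, Nat.mod_eq_of_lt h', if_neg (by omega)]

lemma sum_range_shift_of_periodic {h : ℕ → ℤ} {p : ℕ} (hp : ∀ i, h (i + p) = h i) (c : ℕ) :
    ∑ i ∈ Finset.range p, h (i + c) = ∑ i ∈ Finset.range p, h i := by
  induction c with
  | zero => simp
  | succ c ih =>
    have h1 := Finset.sum_range_succ (fun i => h (i + c)) p
    have h2 := Finset.sum_range_succ' (fun i => h (i + c)) p
    have h3 : h (p + c) = h (0 + c) := by rw [add_comm p c, hp, zero_add]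
    simp only [show ∀ i, i + 1 + c = i + (c + 1) from fun i => by ring] at h2
    linarith

lemma sum_halfInd_step_sq {M : ℕ} (hM : 0 < M) (c : ℕ) :
    ∑ i ∈ Finset.range M, (halfInd M (i + c) - halfInd M (i + (c + 1))) ^ 2 = 1 := by
  have h := sum_range_shift_of_periodic (h := fun i => (halfInd M i - halfInd M (i + 1)) ^ 2)
    (p := M) (fun i => by
      rw [show i + M + 1 = i + 1 + M by ring, halfInd_add_half hM, halfInd_add_half hM]
      ring) c
  simp only [add_assoc] at h
  rw [h]
  obtain ⟨m, rfl⟩ : ∃ m, M = m + 1 := ⟨M - 1, by omega⟩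
  rw [Finset.sum_range_succ, Finset.sum_eq_zero, halfInd_of_lt (by omega),
    halfInd_of_ge (by omega) (by omega)]
  · norm_num
  · intro i hi
    have := Finset.mem_range.mp hi
    rw [halfInd_of_lt (by omega), halfInd_of_lt (by omega)]
    norm_num

lemma sum_halfInd_sub_sq_le {M : ℕ} (hM : 0 < M) (c d : ℕ) :
    ∑ i ∈ Finset.range M, (halfInd M (i + c) - halfInd M (i + (c + d))) ^ 2 ≤ d := by
  induction d with
  | zero => simp
  | succ d ih =>
    have h := sum_halfInd_step_sq hM (c + d)
    push_cast
    rw [← h]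
    refine le_trans ?_ (add_le_add_left ih _)
    rw [← Finset.sum_add_distrib]
    refine Finset.sum_le_sum fun i _ => ?_
    rw [← add_assoc c d 1]
    rcases halfInd_eq_zero_or_one M (i + c) with h1 | h1 <;>
      rcases halfInd_eq_zero_or_one M (i + (c + d)) with h2 | h2 <;>
      rcases halfInd_eq_zero_or_one M (i + (c + d + 1)) with h3 | h3 <;>
      rw [h1, h2, h3] <;> norm_num

lemma sum_halfInd_sub_sq_le_cycDist {M a b : ℕ} (hM : 0 < M) (ha : a < 2 * M) (hb : b < 2 * M)
    (c : ℕ) :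
    ∑ i ∈ Finset.range M, (halfInd M (i + (a + c)) - halfInd M (i + (b + c))) ^ 2 ≤
      cycDist (2 * M) a b := by
  wlog hab : a ≤ b generalizing a b
  · simp only [sub_sq_comm (halfInd M (_ + (a + c)))]
    rw [cycDist, Nat.dist_comm]
    exact this hb ha (by omega)
  have h1 := sum_halfInd_sub_sq_le hM (a + c) (b - a)
  have h2 := sum_halfInd_sub_sq_le hM (b + c) (a + 2 * M - b)
  rw [show a + c + (b - a) = b + c by omega] at h1
  simp only [show ∀ i, i + (b + c + (a + 2 * M - b)) = i + (a + c) + 2 * M by omega,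
    halfInd_add_period, sub_sq_comm (halfInd M (_ + (b + c)))] at h2
  rw [cycDist, Nat.dist_eq_sub_of_le hab, Nat.cast_min]
  refine le_min h1 (h2.trans ?_)
  exact_mod_cast (by omega : a + 2 * M - b ≤ 2 * M - (b - a))

/-! ### Labelings of the vertices by a cycle -/

lemma sum_comp_shift {V : Type*} [Fintype V] {F : V → ℕ} {p : ℕ} (hF : Function.Injective F)
    (hlt : ∀ v, F v < p) (hcard : Fintype.card V = p) {h : ℕ → ℤ} (hp : ∀ i, h (i + p) = h i)
    (t : ℕ) : ∑ v, h (F v + t) = ∑ i ∈ Finset.range p, h i := by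
  classical
  have himg : Finset.univ.image F = Finset.range p := by
    refine Finset.eq_of_subset_of_card_le (fun i hi => ?_) ?_
    · obtain ⟨v, _, rfl⟩ := Finset.mem_image.mp hi
      exact Finset.mem_range.mpr (hlt v)
    · rw [Finset.card_image_of_injective _ hF, Finset.card_univ, hcard, Finset.card_range]
  rw [← sum_range_shift_of_periodic hp t, ← himg, Finset.sum_image hF.injOn]

lemma sum_halfInd (M : ℕ) : ∑ i ∈ Finset.range (2 * M), halfInd M i = M := by
  rw [two_mul, Finset.sum_range_add, Finset.sum_congr rfl fun i hi => halfInd_of_lt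
    (Finset.mem_range.mp hi), Finset.sum_congr rfl fun i hi => halfInd_of_ge (i := M + i)
    (by omega) (by have := Finset.mem_range.mp hi; omega)]
  simp

lemma sum_halfInd_drop_le {M : ℕ} (hM : 0 < M) :
    ∑ i ∈ Finset.range (2 * M), max (halfInd M i - halfInd M (i + 1)) 0 ≤ 1 := by
  have h : ∀ i ∈ Finset.range (2 * M),
      max (halfInd M i - halfInd M (i + 1)) 0 ≤ if i = M - 1 then 1 else 0 := by
    intro i hi
    have hi := Finset.mem_range.mp hi
    rcases lt_or_ge i M with h | h
    · rw [halfInd_of_lt h]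
      rcases lt_or_ge (i + 1) M with h' | h'
      · rw [halfInd_of_lt h', if_neg (by omega)]
        norm_num
      · rw [if_pos (by omega)]
        rcases halfInd_eq_zero_or_one M (i + 1) with h1 | h1 <;> rw [h1] <;> norm_num
    · rw [halfInd_of_ge h hi, if_neg (by omega)]
      rcases halfInd_eq_zero_or_one M (i + 1) with h1 | h1 <;> rw [h1] <;> norm_num
  refine (Finset.sum_le_sum h).trans ?_
  rw [Finset.sum_ite_eq']
  split_ifs <;> norm_num

/-- Excess, over the mean, of the number of vertices with `v j = 1` whose label lies in the
half-circle starting at `-t`. -/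
def arcExcess {r : ℕ} (F : (Fin (r + 2) → Bool) → ℕ) (j : Fin (r + 2)) (t : ℕ) : ℤ :=
  ∑ v, (if v j then halfInd (2 * 2 ^ r) (F v + t) else 0) - 2 ^ r

lemma sum_coord_ite {r : ℕ} (j : Fin (r + 2)) :
    ∑ v : Fin (r + 2) → Bool, (if v j then (1 : ℤ) else 0) = 2 * 2 ^ r := by
  rw [sum_insertBit j]
  simp
  ring

lemma arcExcess_add_half {r : ℕ} (F : (Fin (r + 2) → Bool) → ℕ) (j : Fin (r + 2)) (t : ℕ) :
    arcExcess F j (t + 2 * 2 ^ r) = -arcExcess F j t := by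
  have h : ∀ v, (if v j then halfInd (2 * 2 ^ r) (F v + (t + 2 * 2 ^ r)) else 0) =
      (if v j then 1 else 0) - (if v j then halfInd (2 * 2 ^ r) (F v + t) else 0) := fun v => by
    rw [← add_assoc, halfInd_add_half (by positivity)]
    split_ifs <;> simp
  rw [arcExcess, Finset.sum_congr rfl fun v _ => h v, Finset.sum_sub_distrib, sum_coord_ite,
    arcExcess]
  ring

lemma neg_pow_le_arcExcess {r : ℕ} (F : (Fin (r + 2) → Bool) → ℕ) (j : Fin (r + 2)) (t : ℕ) :
    -2 ^ r ≤ arcExcess F j t := by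
  have : 0 ≤ ∑ v, (if v j then halfInd (2 * 2 ^ r) (F v + t) else 0) :=
    Finset.sum_nonneg fun v _ => by
      rcases halfInd_eq_zero_or_one (2 * 2 ^ r) (F v + t) with h | h <;> rw [h] <;>
        split_ifs <;> norm_num
  rw [arcExcess]
  linarith

lemma abs_arcExcess_le {r : ℕ} (F : (Fin (r + 2) → Bool) → ℕ) (j : Fin (r + 2)) (t : ℕ) :
    |arcExcess F j t| ≤ 2 ^ r := by
  have h1 := neg_pow_le_arcExcess F j t
  have h2 := neg_pow_le_arcExcess F j (t + 2 * 2 ^ r)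
  rw [arcExcess_add_half] at h2
  exact abs_le.mpr ⟨h1, by linarith⟩

section Labeling

variable {r : ℕ} {F : (Fin (r + 2) → Bool) → ℕ}

lemma card_cube_add_two (r : ℕ) : Fintype.card (Fin (r + 2) → Bool) = 2 * (2 * 2 ^ r) := by
  simp
  ring

lemma arcExcess_succ_ge (hF : Function.Injective F) (hlt : ∀ v, F v < 2 * (2 * 2 ^ r))
    (j : Fin (r + 2)) (t : ℕ) : arcExcess F j t - 1 ≤ arcExcess F j (t + 1) := by
  have h1 := sum_comp_shift hF hlt (card_cube_add_two r)
    (h := fun i => max (halfInd (2 * 2 ^ r) i - halfInd (2 * 2 ^ r) (i + 1)) 0)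
    (fun i => by simp only [add_right_comm i _ 1, halfInd_add_period]) t
  have h2 := sum_halfInd_drop_le (M := 2 * 2 ^ r) (by positivity)
  have h3 : ∑ v, (if v j then halfInd (2 * 2 ^ r) (F v + t) else 0) -
      ∑ v, (if v j then halfInd (2 * 2 ^ r) (F v + (t + 1)) else 0) ≤
      ∑ v, max (halfInd (2 * 2 ^ r) (F v + t) - halfInd (2 * 2 ^ r) (F v + t + 1)) 0 := by
    rw [← Finset.sum_sub_distrib]
    refine Finset.sum_le_sum fun v _ => ?_
    split_ifs
    · exact le_max_left _ _
    · exact le_max_right _ _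
  unfold arcExcess
  linarith

lemma sum_halfInd_label (hF : Function.Injective F) (hlt : ∀ v, F v < 2 * (2 * 2 ^ r)) (t : ℕ) :
    ∑ v, halfInd (2 * 2 ^ r) (F v + t) = 2 * 2 ^ r := by
  rw [sum_comp_shift hF hlt (card_cube_add_two r) (halfInd_add_period _), sum_halfInd]
  push_cast
  rfl

/-- Energy of the indicator of the vertices labelled by the half-circle starting at `-t`. -/
def arcEnergy (F : (Fin (r + 2) → Bool) → ℕ) (t : ℕ) : ℤ :=
  energy fun v => halfInd (2 * 2 ^ r) (F v + t)

lemma sum_arcEnergy_le (hlt : ∀ v, F v < 2 * (2 * 2 ^ r)) (c : ℕ) :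
    ∑ i ∈ Finset.range (2 * 2 ^ r), arcEnergy F (c + i) ≤
      edgeSum fun u v => (cycDist (2 * (2 * 2 ^ r)) (F u) (F v) : ℤ) := by
  unfold arcEnergy energy
  rw [← edgeSum_sum]
  refine edgeSum_mono fun u v => ?_
  refine le_trans (le_of_eq ?_)
    (sum_halfInd_sub_sq_le_cycDist (by positivity) (hlt u) (hlt v) c)
  refine Finset.sum_congr rfl fun i _ => ?_
  rw [add_comm i, add_comm i, add_assoc, add_assoc]

lemma arcEnergy_ge (hF : Function.Injective F) (hlt : ∀ v, F v < 2 * (2 * 2 ^ r))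
    (j : Fin (r + 2)) (t : ℕ) : 4 * 2 ^ r + 4 * isoBound r (arcExcess F j t) ≤ arcEnergy F t :=
  energy_ge_of_coord (sum_halfInd_label hF hlt t) (j := j) (by rw [arcExcess]; ring)
    (abs_arcExcess_le F j t)

end Labeling

lemma arcEnergy_ge_or {r : ℕ} {F : (Fin (r + 4) → Bool) → ℕ} (hF : Function.Injective F)
    (hlt : ∀ v, F v < 2 * (2 * 2 ^ (r + 2))) (t : ℕ) :
    6 * 2 ^ (r + 2) ≤ arcEnergy F t ∨ ∃ j, 3 * 2 ^ r < |arcExcess (r := r + 2) F j t| := by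
  by_contra! h
  obtain ⟨h1, h2⟩ := h
  refine h1.not_ge ?_
  have hK : (2 : ℤ) ^ (r + 2) = 4 * 2 ^ r := by ring
  by_cases hb : ∀ j, |arcExcess (r := r + 2) F j t| ≤ 2 ^ r
  · refine energy_ge_of_balanced (sum_halfInd_label hF hlt t)
      (fun v => halfInd_eq_zero_or_one _ _) fun j => ?_
    have h3 : coordSum (fun v => halfInd (2 * 2 ^ (r + 2)) (F v + t)) j =
        2 * arcExcess (r := r + 2) F j t := by
      rw [coordSum_eq, sum_halfInd_label hF hlt, arcExcess]
      ring
    rw [h3, abs_mul, abs_two, hK]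
    linarith [hb j]
  · push Not at hb
    obtain ⟨j, hj⟩ := hb
    have h3 := pow_le_isoBound hj.le (h2 j)
    have h4 := arcEnergy_ge (r := r + 2) hF hlt j t
    rw [isoBound_abs] at h3
    have hK' : (2 : ℤ) ^ (r + 1) = 2 * 2 ^ r := by ring
    rw [hK'] at h3
    rw [hK] at h4 ⊢
    linarith

/-! ### Combining the arcs -/

lemma exists_eq_of_pred_le {q : ℕ → ℤ} (hq : ∀ i, q i - 1 ≤ q (i + 1)) {L : ℕ} {v : ℤ}
    (h0 : v ≤ q 0) (hL : q L < v) : ∃ i < L, q i = v := by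
  induction L with
  | zero => omega
  | succ L ih =>
    by_cases h : q L < v
    · obtain ⟨i, hi, hv⟩ := ih h
      exact ⟨i, by omega, hv⟩
    · exact ⟨L, by omega, by have := hq L; omega⟩

lemma sum_Ioc_isoBound (r m : ℕ) : ∑ v ∈ Finset.Ioc (-m : ℤ) m, isoBound r v = isoTrap r m := by
  induction m with
  | zero => simp [isoTrap_zero]
  | succ m ih =>
    have h : Finset.Ioc (-(m + 1 : ℕ) : ℤ) (m + 1 : ℕ) =
        insert ((m : ℤ) + 1) (insert (-m : ℤ) (Finset.Ioc (-m : ℤ) m)) := by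
      ext v
      simp only [Finset.mem_Ioc, Finset.mem_insert]
      push_cast
      omega
    rw [h, Finset.sum_insert (by simp), Finset.sum_insert (by simp), ih, isoBound_neg,
      isoTrap_succ_right]
    ring

lemma isoTrap_le_sum_of_path {r m x : ℕ} (hmx : m + x = 2 ^ r) {q P : ℕ → ℤ}
    (hq : ∀ i, q i - 1 ≤ q (i + 1)) (h0 : q 0 = m) (hL : q (2 * 2 ^ r) = -m)
    (hP : ∀ i, 4 * isoBound r (q i) ≤ P i) (hx : ∀ i, 2 * isoTrap r x ≤ x * P i) :
    4 * (isoTrap r m + isoTrap r x) ≤ ∑ i ∈ Finset.range (2 * 2 ^ r), P i := by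
  have hit : ∀ v : ℤ, ∃ i, v ∈ Finset.Ioc (-m : ℤ) m → i < 2 * 2 ^ r ∧ q i = v := by
    intro v
    by_cases hv : v ∈ Finset.Ioc (-m : ℤ) m
    · rw [Finset.mem_Ioc] at hv
      obtain ⟨i, hi⟩ := exists_eq_of_pred_le hq (L := 2 * 2 ^ r) (v := v) (by omega) (by omega)
      exact ⟨i, fun _ => hi⟩
    · exact ⟨0, fun h => absurd h hv⟩
  choose c hc using hit
  have hinj : Set.InjOn c (Finset.Ioc (-m : ℤ) m) := fun v hv w hw h => by
    rw [← (hc v hv).2, ← (hc w hw).2, h]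
  set S := (Finset.Ioc (-m : ℤ) m).image c with hS
  have hsub : S ⊆ Finset.range (2 * 2 ^ r) := fun i hi => by
    obtain ⟨v, hv, rfl⟩ := Finset.mem_image.mp hi
    exact Finset.mem_range.mpr (hc v hv).1
  have hcard : S.card = 2 * m := by
    rw [hS, Finset.card_image_of_injOn hinj, Int.card_Ioc]
    omega
  have hcard' : (Finset.range (2 * 2 ^ r) \ S).card = 2 * x := by
    rw [Finset.card_sdiff_of_subset hsub, hcard, Finset.card_range]
    omega
  rw [← Finset.sum_sdiff hsub]
  have h1 : 4 * isoTrap r m ≤ ∑ i ∈ S, P i := by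
    rw [hS, Finset.sum_image hinj, ← sum_Ioc_isoBound, Finset.mul_sum]
    refine Finset.sum_le_sum fun v hv => ?_
    simpa [(hc v hv).2] using hP (c v)
  have h2 : 4 * isoTrap r x ≤ ∑ i ∈ Finset.range (2 * 2 ^ r) \ S, P i := by
    rcases Nat.eq_zero_or_pos x with rfl | hxpos
    · rw [isoTrap_zero]
      exact Finset.sum_nonneg fun i _ => (by linarith [hP i, isoBound_nonneg r (q i)])
    · have h3 := Finset.card_nsmul_le_sum (Finset.range (2 * 2 ^ r) \ S) (fun i => (x : ℤ) * P i)
        (2 * isoTrap r x) fun i _ => hx i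
      rw [hcard', ← Finset.mul_sum, nsmul_eq_mul] at h3
      push_cast at h3
      have hx' : (0 : ℤ) < x := by exact_mod_cast hxpos
      nlinarith
  linarith

/-- Lower bound for the wirelength of a bijective labeling by a cycle. -/
theorem edgeSum_cycDist_ge {r : ℕ} {F : (Fin (r + 4) → Bool) → ℕ} (hF : Function.Injective F)
    (hlt : ∀ v, F v < 2 * (2 * 2 ^ (r + 2))) :
    12 * (2 ^ (r + 2)) ^ 2 - 4 * 2 ^ (r + 2) ≤
      edgeSum fun u v => (cycDist (2 * (2 * 2 ^ (r + 2))) (F u) (F v) : ℤ) := by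
  let q := arcExcess (r := r + 2) F
  have hK : (2 : ℤ) ^ (r + 2) = 4 * 2 ^ r := by ring
  have hKn : 2 ^ (r + 2) = 4 * 2 ^ r := by ring
  have hpos : (0 : ℤ) < 2 ^ r := by positivity
  obtain ⟨m, hmK, ⟨j, t₀, hm⟩, hmax⟩ : ∃ m : ℕ, m ≤ 2 ^ (r + 2) ∧ (∃ j t, q j t = m) ∧
      ∀ j t, |q j t| ≤ m := by
    classical
    have attained : ∀ j t, ∃ t', q j t' = |q j t| := fun j t => by
      rcases abs_choice (q j t) with h | h
      · exact ⟨t, h.symm⟩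
      · exact ⟨_, (arcExcess_add_half F j t).trans h.symm⟩
    have bound : ∀ j t, (q j t).natAbs ≤ 2 ^ (r + 2) := fun j t => by
      have := abs_arcExcess_le (r := r + 2) F j t
      zify
      exact this
    have attained' : ∀ j t, ∃ j' t', q j' t' = ((q j t).natAbs : ℤ) := fun j t =>
      ⟨j, by simpa using attained j t⟩
    refine ⟨Nat.findGreatest (fun m => ∃ j t, q j t = (m : ℤ)) (2 ^ (r + 2)),
      Nat.findGreatest_le _, Nat.findGreatest_spec (P := fun m => ∃ j t, q j t = (m : ℤ))
        (bound 0 0) (attained' 0 0), fun j t => ?_⟩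
    rw [Int.abs_eq_natAbs]
    exact_mod_cast Nat.le_findGreatest (bound j t) (attained' j t)
  refine le_trans ?_ (sum_arcEnergy_le (r := r + 2) hlt t₀)
  by_cases hmid : 2 * m < 2 ^ (r + 2)
  · have hE : ∀ i ∈ Finset.range (2 * 2 ^ (r + 2)),
        6 * 2 ^ (r + 2) ≤ arcEnergy (r := r + 2) F (t₀ + i) := fun i _ => by
      refine (arcEnergy_ge_or hF hlt _).resolve_right ?_
      rintro ⟨j, hj⟩
      have h1 := hmax j (t₀ + i)
      have h2 : (2 * m : ℤ) < 2 ^ (r + 2) := by exact_mod_cast hmid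
      change _ < |q j (t₀ + i)| at hj
      linarith
    have h := Finset.card_nsmul_le_sum _ _ _ hE
    rw [Finset.card_range, nsmul_eq_mul] at h
    push_cast at h
    nlinarith
  · obtain ⟨x, hx⟩ := Nat.exists_eq_add_of_le hmK
    have hxz : (2 : ℤ) ^ (r + 2) = m + x := by exact_mod_cast hx
    have h := isoTrap_le_sum_of_path (r := r + 2) hx.symm
      (q := fun i => q j (t₀ + i))
      (P := fun i => arcEnergy (r := r + 2) F (t₀ + i) - 4 * 2 ^ (r + 2))
      (fun i => arcExcess_succ_ge hF hlt j _) hm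
      (by rw [← hm]; exact arcExcess_add_half F j t₀)
      (fun i => by linarith [arcEnergy_ge (r := r + 2) hF hlt j (t₀ + i)]) fun i => by
        rcases arcEnergy_ge_or hF hlt (t₀ + i) with hE | ⟨k, hk⟩
        · have h1 := isoTrap_le_mul_pow (r := r + 1) (x := x) (by rw [pow_succ] at hx hmid; omega)
          have h2 : (x : ℤ) * (2 * 2 ^ (r + 2)) ≤
              x * (arcEnergy (r := r + 2) F (t₀ + i) - 4 * 2 ^ (r + 2)) :=
            mul_le_mul_of_nonneg_left (by linarith) (by positivity)
          linarith
        · have h1 : (q k (t₀ + i)).natAbs ≤ m := by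
            zify
            exact hmax k _
          have hk' : 3 * 2 ^ r < (q k (t₀ + i)).natAbs := by
            zify
            exact hk
          have h2 := isoTrap_le_mul_isoBound (r := r + 2) (x := x) (y := (q k (t₀ + i)).natAbs)
            (by omega) (by omega)
          have h3 := arcEnergy_ge (r := r + 2) hF hlt k (t₀ + i)
          rw [Int.natCast_natAbs, isoBound_abs] at h2
          have h4 : (x : ℤ) * (4 * isoBound (r + 2) (q k (t₀ + i))) ≤
              x * (arcEnergy (r := r + 2) F (t₀ + i) - 4 * 2 ^ (r + 2)) :=
            mul_le_mul_of_nonneg_left (by linarith) (by positivity)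
          linarith
    rw [isoTrap_add_isoTrap hx.symm, isoTrap_pow, Finset.sum_sub_distrib, Finset.sum_const,
      Finset.card_range, nsmul_eq_mul] at h
    push_cast at h
    nlinarith

/-! ### Short linear orderings of vertex subsets -/

/-- The part of `A` on the side `b` of the first coordinate. -/
def sideOf {n : ℕ} (b : Bool) (A : Finset (Fin (n + 1) → Bool)) : Finset (Fin n → Bool) :=
  Finset.univ.filter fun u => insertBit 0 b u ∈ A

lemma mem_sideOf {n : ℕ} {b : Bool} {A : Finset (Fin (n + 1) → Bool)} {u : Fin n → Bool} :
    u ∈ sideOf b A ↔ insertBit 0 b u ∈ A := by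
  simp [sideOf]

lemma insertBit_zero_tail {n : ℕ} (w : Fin (n + 1) → Bool) :
    insertBit 0 (w 0) (fun i => w i.succ) = w := by
  funext i
  refine Fin.cases ?_ (fun i => ?_) i
  · exact insertBit_same 0 (w 0) _
  · exact insertBit_zero_succ (w 0) _ i

lemma card_sideOf {n : ℕ} (A : Finset (Fin (n + 1) → Bool)) :
    (sideOf false A).card + (sideOf true A).card = A.card := by
  have h : ∀ B : Finset (Fin (n + 1) → Bool), B.card = ∑ w, if w ∈ B then 1 else 0 := by simp
  rw [h A, sum_insertBit 0]
  simp [sideOf]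

/-- `o` numbers the vertices of `A` injectively by naturals less than `A.card`. -/
structure IsNumbering {n : ℕ} (A : Finset (Fin n → Bool)) (o : (Fin n → Bool) → ℕ) : Prop where
  injOn : Set.InjOn o A
  lt_card : ∀ v ∈ A, o v < A.card

/-- Linear wirelength (over ordered pairs) of the subgraph induced on `A`. -/
def numberingCost {n : ℕ} (A : Finset (Fin n → Bool)) (o : (Fin n → Bool) → ℕ) : ℤ :=
  edgeSum fun u v => if u ∈ A ∧ v ∈ A then |(o u : ℤ) - o v| else 0

lemma IsNumbering.reverse {n : ℕ} {A : Finset (Fin n → Bool)} {o : (Fin n → Bool) → ℕ}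
    (h : IsNumbering A o) : IsNumbering A fun v => A.card - 1 - o v where
  injOn u hu v hv huv := h.injOn hu hv (by
    have := h.lt_card u hu
    have := h.lt_card v hv
    dsimp only at huv
    omega)
  lt_card v hv := by
    have := h.lt_card v hv
    omega

lemma IsNumbering.numberingCost_reverse {n : ℕ} {A : Finset (Fin n → Bool)}
    {o : (Fin n → Bool) → ℕ} (h : IsNumbering A o) :
    numberingCost A (fun v => A.card - 1 - o v) = numberingCost A o := by
  unfold numberingCost
  congr 1
  funext u v
  split_ifs with huv
  · have := h.lt_card u huv.1
    have := h.lt_card v huv.2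
    rw [abs_sub_comm (o u : ℤ)]
    congr 1
    dsimp only
    omega
  · rfl

/-- Number one side of `A` after the other. -/
def joinNumbering {n : ℕ} (a : ℕ) (p₀ p₁ : (Fin n → Bool) → ℕ) (w : Fin (n + 1) → Bool) : ℕ :=
  if w 0 then a + p₁ (fun i => w i.succ) else p₀ (fun i => w i.succ)

lemma joinNumbering_insertBit {n : ℕ} (a : ℕ) (p₀ p₁ : (Fin n → Bool) → ℕ) (b : Bool)
    (u : Fin n → Bool) :
    joinNumbering a p₀ p₁ (insertBit 0 b u) = if b then a + p₁ u else p₀ u := by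
  simp [joinNumbering]

lemma IsNumbering.join {n : ℕ} {A : Finset (Fin (n + 1) → Bool)} {p₀ p₁ : (Fin n → Bool) → ℕ}
    (h₀ : IsNumbering (sideOf false A) p₀) (h₁ : IsNumbering (sideOf true A) p₁) :
    IsNumbering A (joinNumbering (sideOf false A).card p₀ p₁) := by
  have hA := card_sideOf A
  have side : ∀ w ∈ A, ∃ b u, w = insertBit 0 b u ∧ u ∈ sideOf b A := fun w hw =>
    ⟨w 0, fun i => w i.succ, (insertBit_zero_tail w).symm,
      by rwa [mem_sideOf, insertBit_zero_tail]⟩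
  constructor
  · intro w hw w' hw' h
    obtain ⟨b, u, rfl, hu⟩ := side w hw
    obtain ⟨c, v, rfl, hv⟩ := side w' hw'
    rw [joinNumbering_insertBit, joinNumbering_insertBit] at h
    cases b <;> cases c <;> simp only [Bool.false_eq_true, if_true, if_false] at h
    · rw [h₀.injOn hu hv h]
    · have := h₀.lt_card u hu
      omega
    · have := h₀.lt_card v hv
      omega
    · rw [h₁.injOn hu hv (by omega)]
  · intro w hw
    obtain ⟨b, u, rfl, hu⟩ := side w hw
    rw [joinNumbering_insertBit]
    cases b <;> simp only [Bool.false_eq_true, if_true, if_false]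
    · have := h₀.lt_card u hu
      omega
    · have := h₁.lt_card u hu
      omega

lemma numberingCost_join {n : ℕ} {A : Finset (Fin (n + 1) → Bool)} {p₀ p₁ : (Fin n → Bool) → ℕ}
    (h₀ : IsNumbering (sideOf false A) p₀) :
    numberingCost A (joinNumbering (sideOf false A).card p₀ p₁) =
      numberingCost (sideOf false A) p₀ + numberingCost (sideOf true A) p₁ +
        2 * ∑ u ∈ sideOf false A ∩ sideOf true A,
          (((sideOf false A).card : ℤ) + p₁ u - p₀ u) := by
  unfold numberingCost
  rw [edgeSum_insertBit 0]
  simp only [joinNumbering_insertBit, ← mem_sideOf]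
  congr 1
  · congr 2
    funext u v
    simp
  · rw [Finset.mul_sum, ← Finset.sum_filter_of_ne (p := (· ∈ sideOf false A ∩ sideOf true A))]
    · rw [Finset.filter_univ_mem]
      refine Finset.sum_congr rfl fun u hu => ?_
      rw [Finset.mem_inter] at hu
      have := h₀.lt_card u hu.1
      rw [if_pos hu, if_pos hu.symm]
      simp only [Bool.false_eq_true, if_true, if_false]
      rw [abs_of_nonpos (by omega), abs_of_nonneg (by omega)]
      push_cast
      ring
    · intro u _ hu
      rw [Finset.mem_inter]
      by_contra h
      rw [if_neg h, if_neg fun h' => h h'.symm] at hu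
      exact hu rfl

/-- Every set `A` of vertices has a numbering whose linear wirelength is at most the number of
ordered pairs of distinct elements of `A`. -/
lemma exists_numbering {n : ℕ} (A : Finset (Fin n → Bool)) :
    ∃ o, IsNumbering A o ∧ numberingCost A o ≤ A.card * (A.card - 1) := by
  induction n with
  | zero =>
    refine ⟨fun _ => 0, ⟨fun u _ v _ _ => Subsingleton.elim u v, fun v hv =>
      Finset.card_pos.mpr ⟨v, hv⟩⟩, ?_⟩
    rw [numberingCost, edgeSum_zero_dim]
    rcases Nat.eq_zero_or_pos A.card with h | h
    · simp [h]
    · have : (1 : ℤ) ≤ A.card := by exact_mod_cast h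
      nlinarith
  | succ n ih =>
    obtain ⟨o₀, h₀, hc₀⟩ := ih (sideOf false A)
    obtain ⟨o₁, h₁, hc₁⟩ := ih (sideOf true A)
    have e₁ := numberingCost_join h₀ (p₁ := o₁)
    have e₂ := numberingCost_join h₀.reverse (p₁ := fun v => (sideOf true A).card - 1 - o₁ v)
    rw [h₀.numberingCost_reverse, h₁.numberingCost_reverse] at e₂
    have hA : ((sideOf false A).card + (sideOf true A).card : ℤ) = A.card := by
      exact_mod_cast card_sideOf A
    have hcross : ∑ u ∈ sideOf false A ∩ sideOf true A,
          (((sideOf false A).card : ℤ) + o₁ u - o₀ u) +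
        ∑ u ∈ sideOf false A ∩ sideOf true A,
          (((sideOf false A).card : ℤ) + ((sideOf true A).card - 1 - o₁ u : ℕ) -
            ((sideOf false A).card - 1 - o₀ u : ℕ)) =
        (sideOf false A ∩ sideOf true A).card *
          ((sideOf false A).card + (sideOf true A).card) := by
      rw [← Finset.sum_add_distrib, ← nsmul_eq_mul]
      refine Finset.sum_eq_card_nsmul fun u hu => ?_
      rw [Finset.mem_inter] at hu
      have := h₀.lt_card u hu.1
      have := h₁.lt_card u hu.2
      omega
    have hi₀ : ((sideOf false A ∩ sideOf true A).card : ℤ) ≤ (sideOf false A).card := by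
      exact_mod_cast Finset.card_le_card Finset.inter_subset_left
    have hi₁ : ((sideOf false A ∩ sideOf true A).card : ℤ) ≤ (sideOf true A).card := by
      exact_mod_cast Finset.card_le_card Finset.inter_subset_right
    have hmul : ((sideOf false A ∩ sideOf true A).card : ℤ) *
        ((sideOf false A).card + (sideOf true A).card) ≤
        2 * (sideOf false A).card * (sideOf true A).card := by
      nlinarith
    rw [← hA]
    by_cases hle : numberingCost A (joinNumbering (sideOf false A).card o₀ o₁) ≤
        ((sideOf false A).card + (sideOf true A).card) *
          ((sideOf false A).card + (sideOf true A).card - 1)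
    · exact ⟨_, h₀.join h₁, hle⟩
    · exact ⟨_, h₀.reverse.join h₁.reverse, by nlinarith⟩

/-! ### Labelings by a cycle with equal fibers -/

lemma cycDist_refine_le {L M f g o p : ℕ} (hf : f < L) (hg : g < L) (ho : o < M) (hp : p < M) :
    (cycDist (L * M) (M * f + o) (M * g + p) : ℤ) +
        cycDist (L * M) (M * f + (M - 1 - o)) (M * g + (M - 1 - p)) ≤
      2 * M * cycDist L f g + 2 * if f = g then |(o : ℤ) - p| else 0 := by
  wlog hfg : f ≤ g generalizing f g o p
  · have h := this hg hf hp ho (by omega)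
    simp only [cycDist, Nat.dist_comm (M * f + _), Nat.dist_comm f, eq_comm (a := f),
      abs_sub_comm (o : ℤ)]
    exact h
  rcases hfg.eq_or_lt with rfl | hlt
  · rw [if_pos rfl]
    have h1 : cycDist (L * M) (M * f + o) (M * f + p) ≤ Nat.dist o p := by
      rw [cycDist, Nat.dist_add_add_left]
      exact min_le_left _ _
    have h2 : cycDist (L * M) (M * f + (M - 1 - o)) (M * f + (M - 1 - p)) ≤ Nat.dist o p := by
      rw [cycDist, Nat.dist_add_add_left]
      refine (min_le_left _ _).trans ?_
      unfold Nat.dist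
      omega
    have h3 : (Nat.dist o p : ℤ) = |(o : ℤ) - p| := by
      unfold Nat.dist
      rcases abs_cases ((o : ℤ) - p) with h | h <;> omega
    have h4 : (0 : ℤ) ≤ 2 * M * cycDist L f f := by positivity
    rw [← h3]
    omega
  · obtain ⟨d, rfl⟩ := Nat.exists_eq_add_of_lt hlt
    obtain ⟨e, rfl⟩ := Nat.exists_eq_add_of_lt hg
    rw [if_neg (by omega)]
    have h1 : Nat.dist (M * f + o) (M * (f + d + 1) + p) = M * d + (M + p - o) := by
      rw [Nat.dist_eq_sub_of_le] <;> simp only [mul_add, mul_one] <;> omega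
    have h2 : Nat.dist (M * f + (M - 1 - o)) (M * (f + d + 1) + (M - 1 - p)) =
        M * d + (M + o - p) := by
      rw [Nat.dist_eq_sub_of_le] <;> simp only [mul_add, mul_one] <;> omega
    have h3 : Nat.dist f (f + d + 1) = d + 1 := by
      rw [Nat.dist_eq_sub_of_le] <;> omega
    have h4 : (f + d + 1 + e + 1) * M = M * f + M * d + M * e + 2 * M := by ring
    have h5 : f + d + 1 + e + 1 - (d + 1) = f + e + 1 := by omega
    have h6 : (M : ℤ) * (f + e + 1) = M * f + M * e + M := by ring
    have h7 : (M : ℤ) * (d + 1) = M * d + M := by ring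
    simp only [cycDist, h1, h2, h3, h5, mul_assoc]
    rw [h4]
    rcases le_total (d + 1) (f + e + 1) with h | h
    · rw [min_eq_left h]
      push_cast
      rw [h7]
      have := min_le_left (M * d + (M + p - o))
        (M * f + M * d + M * e + 2 * M - (M * d + (M + p - o)))
      have := min_le_left (M * d + (M + o - p))
        (M * f + M * d + M * e + 2 * M - (M * d + (M + o - p)))
      zify at *
      omega
    · rw [min_eq_right h]
      push_cast
      rw [h6]
      have := min_le_right (M * d + (M + p - o))
        (M * f + M * d + M * e + 2 * M - (M * d + (M + p - o)))
      have := min_le_right (M * d + (M + o - p))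
        (M * f + M * d + M * e + 2 * M - (M * d + (M + o - p)))
      zify at *
      omega

lemma injective_refine {n M : ℕ} {f o : (Fin n → Bool) → ℕ} (ho : ∀ v, o v < M)
    (hinj : ∀ u v, f u = f v → o u = o v → u = v) :
    Function.Injective fun v => M * f v + o v := by
  intro u v huv
  dsimp only at huv
  have hu := ho u
  have hv := ho v
  have hM : 0 < M := by omega
  have h1 : f u = f v := by
    have := congrArg (· / M) huv
    simpa [Nat.mul_add_div hM, Nat.div_eq_of_lt hu, Nat.div_eq_of_lt hv] using this
  rw [h1] at huv
  exact hinj u v h1 (by omega)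

/-- Lower bound for the wirelength of a labeling by a cycle of length `4 * k`, all of whose fibers
have `M` elements. -/
theorem edgeSum_cycDist_ge_of_fibers {n k M : ℕ} (hn : 4 ≤ n) (hM : 4 * k * M = 2 ^ n)
    {f : (Fin n → Bool) → ℕ} (hf : ∀ v, f v < 4 * k)
    (hfib : ∀ i < 4 * k, (Finset.univ.filter fun v => f v = i).card = M) :
    (2 * M * (6 * k ^ 2 - 2 * k) : ℤ) ≤
      edgeSum fun u v => (cycDist (4 * k) (f u) (f v) : ℤ) := by
  obtain ⟨r, rfl⟩ : ∃ r, n = r + 4 := ⟨n - 4, by omega⟩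
  have hK : 2 ^ (r + 2) = k * M := by
    have : 2 ^ (r + 4) = 4 * 2 ^ (r + 2) := by ring
    linarith
  choose num hnum hcost using fun i : ℕ =>
    exists_numbering (Finset.univ.filter fun v : Fin (r + 4) → Bool => f v = i)
  let o : (Fin (r + 4) → Bool) → ℕ := fun v => num (f v) v
  have ho : ∀ v, o v < M := fun v => by
    rw [← hfib (f v) (hf v)]
    exact (hnum (f v)).lt_card v (by simp)
  have hinj : ∀ u v, f u = f v → o u = o v → u = v := fun u v h1 h2 => by
    refine (hnum (f v)).injOn (by simp [h1]) (by simp) ?_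
    simpa only [o, h1] using h2
  have hlt : ∀ (p : (Fin (r + 4) → Bool) → ℕ), (∀ v, p v < M) → ∀ v,
      M * f v + p v < 2 * (2 * 2 ^ (r + 2)) := fun p hp v => by
    have := hp v
    have := hf v
    rw [hK]
    nlinarith
  have b₁ := edgeSum_cycDist_ge (injective_refine ho hinj) (hlt o ho)
  have ho' : ∀ v, M - 1 - o v < M := fun v => by have := ho v; omega
  have b₂ := edgeSum_cycDist_ge (injective_refine ho' fun u v h1 h2 => hinj u v h1 (by
    have := ho u
    have := ho v
    omega)) (hlt _ ho')
  have hlen : 2 * (2 * 2 ^ (r + 2)) = 4 * k * M := by rw [hK]; ring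
  rw [hlen] at b₁ b₂
  have hfibers : edgeSum (fun u v => if f u = f v then |(o u : ℤ) - o v| else 0) ≤
      4 * k * (M * (M - 1)) := by
    have h1 : (fun u v => if f u = f v then |(o u : ℤ) - o v| else 0) = fun u v =>
        ∑ i ∈ Finset.range (4 * k), if u ∈ (Finset.univ.filter fun v => f v = i) ∧
          v ∈ (Finset.univ.filter fun v => f v = i) then |(num i u : ℤ) - num i v| else 0 := by
      funext u v
      simp only [Finset.mem_filter, Finset.mem_univ, true_and]
      rw [Finset.sum_eq_single (f u)]
      · by_cases h : f u = f v
        · simp [h, o]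
        · rw [if_neg h, if_neg fun h' => h h'.2.symm]
      · intro i _ hi
        rw [if_neg fun h => hi h.1.symm]
      · intro h
        exact absurd (Finset.mem_range.mpr (hf u)) h
    rw [h1, edgeSum_sum]
    refine (Finset.sum_le_card_nsmul _ _ ((M : ℤ) * (M - 1)) fun i hi => ?_).trans ?_
    · have := hcost i
      rwa [hfib i (Finset.mem_range.mp hi)] at this
    · rw [Finset.card_range, nsmul_eq_mul]
      push_cast
      rfl
  have hpair := edgeSum_mono fun u v => cycDist_refine_le (hf u) (hf v) (ho u) (ho v)
  rw [edgeSum_add, edgeSum_add, edgeSum_mul_left, edgeSum_mul_left] at hpair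
  have hKz : (2 : ℤ) ^ (r + 2) = k * M := by exact_mod_cast hK
  rw [hKz] at b₁ b₂
  have hMpos : (0 : ℤ) < M := by exact_mod_cast (ho fun _ => false).pos
  refine le_of_mul_le_mul_left ?_ hMpos
  nlinarith

lemma edgeSum_natCast {n : ℕ} (F : (Fin n → Bool) → (Fin n → Bool) → ℕ) :
    ((edgeSum F : ℕ) : ℤ) = edgeSum fun u v => (F u v : ℤ) := by
  simp only [edgeSum]
  push_cast
  rfl

lemma natCast_cycle_wirelength {a : ℕ} (ha : 2 ≤ a) :
    ((3 * 2 ^ (2 * a - 3) - 2 ^ (a - 1) : ℕ) : ℤ) =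
      6 * (2 ^ (a - 2)) ^ 2 - 2 * 2 ^ (a - 2) := by
  obtain ⟨c, rfl⟩ := Nat.exists_eq_add_of_le' ha
  have h1 : 2 * (c + 2) - 3 = 2 * c + 1 := by omega
  have h2 : c + 2 - 1 = c + 1 := by omega
  have h3 : c + 2 - 2 = c := by omega
  have hle : 2 ^ (c + 1) ≤ 3 * 2 ^ (2 * c + 1) := by
    have := Nat.pow_le_pow_right (show 0 < 2 by norm_num) (show c + 1 ≤ 2 * c + 1 by omega)
    omega
  rw [h1, h2, h3, Nat.cast_sub hle]
  push_cast
  ring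

lemma edgeSum_cycDist_ge_of_card_fiber {n a b : ℕ} (hn : 4 ≤ n) (ha : 2 ≤ a) (hab : a + b = n)
    {g : (Fin n → Bool) → ℕ} (hg : ∀ v, g v ∈ Set.Icc 1 (2 ^ a))
    (hfib : ∀ i ∈ Set.Icc 1 (2 ^ a), (Finset.univ.filter fun v => g v = i).card = 2 ^ b) :
    2 * (2 ^ b * (3 * 2 ^ (2 * a - 3) - 2 ^ (a - 1))) ≤
      edgeSum fun u v => cycDist (2 ^ a) (g u) (g v) := by
  have hk : 4 * 2 ^ (a - 2) = 2 ^ a := by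
    rw [show 4 = 2 ^ 2 by norm_num, ← pow_add]
    congr 1
    omega
  have h := edgeSum_cycDist_ge_of_fibers (k := 2 ^ (a - 2)) (M := 2 ^ b) hn
    (by rw [hk, ← pow_add, hab]) (f := fun v => g v - 1)
    (fun v => by
      have := hg v
      simp only [Set.mem_Icc] at this
      omega)
    (fun i hi => by
      rw [← hfib (i + 1) ⟨by omega, by omega⟩]
      congr 1
      ext v
      have := (hg v).1
      simp only [Finset.mem_filter, Finset.mem_univ, true_and]
      omega)
  have hshift : ∀ u v, cycDist (2 ^ a) (g u - 1) (g v - 1) = cycDist (2 ^ a) (g u) (g v) := by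
    intro u v
    have := (hg u).1
    have := (hg v).1
    have : Nat.dist (g u - 1) (g v - 1) = Nat.dist (g u) (g v) := by
      unfold Nat.dist
      omega
    rw [cycDist, cycDist, this]
  simp only [hk, hshift] at h
  zify
  rw [natCast_cycle_wirelength ha, edgeSum_natCast]
  push_cast at h
  linarith

lemma card_filter_fst_eq {V : Type*} [Fintype V] {f : V → ℕ × ℕ} {A B : ℕ}
    (hf : Set.BijOn f Set.univ (Set.Icc 1 A ×ˢ Set.Icc 1 B)) {i : ℕ} (hi : i ∈ Set.Icc 1 A) :
    (Finset.univ.filter fun v => (f v).1 = i).card = B := by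
  rw [show B = (Finset.Icc 1 B).card by simp]
  refine Finset.card_nbij (fun v => (f v).2) ?_ ?_ ?_
  · intro v _
    have := hf.mapsTo (Set.mem_univ v)
    simpa using this.2
  · intro u hu v hv h
    simp only [Finset.coe_filter, Finset.mem_univ, true_and, Set.mem_ofPred_eq] at hu hv
    exact hf.injOn (Set.mem_univ u) (Set.mem_univ v) (Prod.ext (hu.trans hv.symm) h)
  · intro y hy
    obtain ⟨v, _, hv⟩ := hf.surjOn (show (i, y) ∈ _ from ⟨hi, by simpa using hy⟩)
    exact ⟨v, by simp [hv], by simp [hv]⟩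

lemma wirelength_torusDist_ge {n₁ n₂ : ℕ} (h₁ : 2 ≤ n₁) (h₂ : 2 ≤ n₂)
    {f : (Fin (n₁ + n₂) → Bool) → ℕ × ℕ}
    (hf : Set.BijOn f Set.univ ((Set.Icc 1 (2 ^ n₁)) ×ˢ (Set.Icc 1 (2 ^ n₂)))) :
    2 ^ n₂ * (3 * 2 ^ (2 * n₁ - 3) - 2 ^ (n₁ - 1)) +
        2 ^ n₁ * (3 * 2 ^ (2 * n₂ - 3) - 2 ^ (n₂ - 1)) ≤
      wirelength (torusDist (2 ^ n₁) (2 ^ n₂)) f := by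
  have hswap : Set.BijOn (fun v => (f v).swap) Set.univ
      ((Set.Icc 1 (2 ^ n₂)) ×ˢ (Set.Icc 1 (2 ^ n₁))) := by
    have : Set.BijOn Prod.swap ((Set.Icc 1 (2 ^ n₁)) ×ˢ (Set.Icc 1 (2 ^ n₂)))
        ((Set.Icc 1 (2 ^ n₂)) ×ˢ (Set.Icc 1 (2 ^ n₁))) :=
      ⟨fun p hp => ⟨hp.2, hp.1⟩, Prod.swap_injective.injOn,
        fun p hp => ⟨p.swap, ⟨hp.2, hp.1⟩, p.swap_swap⟩⟩
    exact this.comp hf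
  have b₁ := edgeSum_cycDist_ge_of_card_fiber (by omega) h₁ rfl
    (fun v => (hf.mapsTo (Set.mem_univ v)).1) fun i hi => card_filter_fst_eq hf hi
  have b₂ := edgeSum_cycDist_ge_of_card_fiber (by omega) h₂ (add_comm n₂ n₁)
    (fun v => (hf.mapsTo (Set.mem_univ v)).2) fun i hi => card_filter_fst_eq hswap hi
  have h : wirelength (torusDist (2 ^ n₁) (2 ^ n₂)) f =
      ((edgeSum fun u v => cycDist (2 ^ n₁) (f u).1 (f v).1) +
        edgeSum fun u v => cycDist (2 ^ n₂) (f u).2 (f v).2) / 2 := by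
    rw [← edgeSum_add]
    rfl
  rw [h]
  omega

/-! ### The Gray code embedding -/

lemma gray_mem_Icc (n : ℕ) (v : Fin n → Bool) : gray n v ∈ Set.Icc 1 (2 ^ n) := by
  induction n with
  | zero => simp [gray]
  | succ n ih =>
    have h := ih fun i => v i.succ
    simp only [Set.mem_Icc, gray, pow_succ] at h ⊢
    split_ifs <;> omega

lemma gray_insertBit_false {n : ℕ} (u : Fin n → Bool) :
    gray (n + 1) (insertBit 0 false u) = gray n u := by
  simp [gray]

lemma gray_insertBit_true {n : ℕ} (u : Fin n → Bool) :
    gray (n + 1) (insertBit 0 true u) = 2 ^ (n + 1) + 1 - gray n u := by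
  simp [gray]

lemma gray_injective (n : ℕ) : Function.Injective (gray n) := by
  induction n with
  | zero => exact Function.injective_of_subsingleton _
  | succ n ih =>
    intro u v huv
    rw [← insertBit_zero_tail u, ← insertBit_zero_tail v] at huv ⊢
    have hu := gray_mem_Icc n fun i => u i.succ
    have hv := gray_mem_Icc n fun i => v i.succ
    simp only [Set.mem_Icc] at hu hv
    generalize u 0 = b at *
    generalize v 0 = c at *
    cases b <;> cases c <;>
      simp only [gray_insertBit_false, gray_insertBit_true, pow_succ] at huv
    · rw [ih huv]
    · omega
    · omega
    · rw [ih (show gray n (fun i => u i.succ) = gray n fun i => v i.succ by omega)]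

lemma gray_bijOn (n : ℕ) : Set.BijOn (gray n) Set.univ (Set.Icc 1 (2 ^ n)) := by
  refine ⟨fun v _ => gray_mem_Icc n v, (gray_injective n).injOn, ?_⟩
  have h : Finset.univ.image (gray n) = Finset.Icc 1 (2 ^ n) := by
    refine Finset.eq_of_subset_of_card_le (fun i hi => ?_) ?_
    · obtain ⟨v, _, rfl⟩ := Finset.mem_image.mp hi
      simpa using gray_mem_Icc n v
    · rw [Finset.card_image_of_injective _ (gray_injective n)]
      simp
  intro y hy
  obtain ⟨v, _, hv⟩ := Finset.mem_image.mp (h ▸ Finset.mem_Icc.mpr hy)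
  exact ⟨v, Set.mem_univ v, hv⟩

lemma natCast_gray_insertBit_true {n : ℕ} (u : Fin n → Bool) :
    (gray (n + 1) (insertBit 0 true u) : ℤ) = 2 * 2 ^ n + 1 - gray n u := by
  have h := (gray_mem_Icc n u).2
  rw [gray_insertBit_true, Nat.cast_sub (by rw [pow_succ]; omega)]
  push_cast
  ring

lemma sum_gray (n : ℕ) : 2 * ∑ v, (gray n v : ℤ) = 2 ^ n * (2 ^ n + 1) := by
  cases n with
  | zero => simp [gray]
  | succ n =>
    rw [sum_insertBit 0]
    simp only [gray_insertBit_false, natCast_gray_insertBit_true, Finset.sum_sub_distrib,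
      Finset.sum_const, Finset.card_univ, Fintype.card_pi, Fintype.card_bool,
      Finset.prod_const, Fintype.card_fin, nsmul_eq_mul]
    push_cast
    ring

lemma edgeSum_abs_gray_sub (n : ℕ) :
    edgeSum (fun u v => |(gray n u : ℤ) - gray n v|) = 2 ^ n * (2 ^ n - 1) := by
  induction n with
  | zero => simp [edgeSum_zero_dim]
  | succ n ih =>
    rw [edgeSum_insertBit 0]
    have hcross : ∀ u, |(gray (n + 1) (insertBit 0 false u) : ℤ) -
        gray (n + 1) (insertBit 0 true u)| + |(gray (n + 1) (insertBit 0 true u) : ℤ) -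
        gray (n + 1) (insertBit 0 false u)| = 2 * (2 * 2 ^ n + 1 - 2 * (gray n u : ℤ)) := by
      intro u
      have h : (gray n u : ℤ) ≤ 2 ^ n := by exact_mod_cast (gray_mem_Icc n u).2
      rw [natCast_gray_insertBit_true, gray_insertBit_false, abs_of_nonpos (by linarith),
        abs_of_nonneg (by linarith)]
      ring
    simp only [hcross]
    simp only [gray_insertBit_false, natCast_gray_insertBit_true, sub_sub_sub_cancel_left]
    have hS := sum_gray n
    have hrev : edgeSum (fun u v => |(gray n v : ℤ) - gray n u|) = 2 ^ n * (2 ^ n - 1) := by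
      simpa only [abs_sub_comm] using ih
    rw [ih, hrev, ← Finset.mul_sum, Finset.sum_sub_distrib, ← Finset.mul_sum, hS]
    simp only [Finset.sum_const, Finset.card_univ, Fintype.card_pi, Fintype.card_bool,
      Finset.prod_const, Fintype.card_fin, nsmul_eq_mul]
    push_cast
    ring

lemma natCast_cycDist {m a b : ℕ} (ha : a ∈ Set.Icc 1 m) (hb : b ∈ Set.Icc 1 m) :
    (cycDist m a b : ℤ) = min |(a : ℤ) - b| (m - |(a : ℤ) - b|) := by
  obtain ⟨ha₁, ha₂⟩ := ha
  obtain ⟨hb₁, hb₂⟩ := hb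
  unfold cycDist Nat.dist
  rw [abs_eq_max_neg]
  omega

lemma edgeSum_cycDist_gray (l : ℕ) :
    edgeSum (fun u v => (cycDist (2 ^ (l + 2)) (gray (l + 2) u) (gray (l + 2) v) : ℤ)) =
      12 * (2 ^ l) ^ 2 - 4 * 2 ^ l := by
  have bound : ∀ n v, (1 : ℤ) ≤ gray n v ∧ (gray n v : ℤ) ≤ 2 ^ n := fun n v => by
    have := gray_mem_Icc n v
    simp only [Set.mem_Icc] at this
    exact_mod_cast this
  have h2 : (2 : ℤ) ^ (l + 1) = 2 * 2 ^ l := by ring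
  have h4 : (2 : ℤ) ^ (l + 2) = 4 * 2 ^ l := by ring
  have same : ∀ b (u v : Fin (l + 1) → Bool),
      (cycDist (2 ^ (l + 2)) (gray (l + 2) (insertBit 0 b u)) (gray (l + 2) (insertBit 0 b v)) :
        ℤ) = |(gray (l + 1) u : ℤ) - gray (l + 1) v| := by
    intro b u v
    have hu := bound _ u
    have hv := bound _ v
    rw [natCast_cycDist (gray_mem_Icc _ _) (gray_mem_Icc _ _)]
    push_cast
    cases b <;> simp only [gray_insertBit_false, natCast_gray_insertBit_true, abs_eq_max_neg] <;>
      omega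
  have cross : ∀ u : Fin (l + 1) → Bool,
      (cycDist (2 ^ (l + 2)) (gray (l + 2) (insertBit 0 false u))
        (gray (l + 2) (insertBit 0 true u)) : ℤ) +
      cycDist (2 ^ (l + 2)) (gray (l + 2) (insertBit 0 true u))
        (gray (l + 2) (insertBit 0 false u)) =
      2 * min (2 * (gray (l + 1) u : ℤ) - 1) (2 * 2 ^ (l + 1) + 1 - 2 * gray (l + 1) u) := by
    intro u
    have hu := bound _ u
    rw [natCast_cycDist (gray_mem_Icc _ _) (gray_mem_Icc _ _),
      natCast_cycDist (gray_mem_Icc _ _) (gray_mem_Icc _ _)]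
    push_cast
    simp only [gray_insertBit_false, natCast_gray_insertBit_true, abs_eq_max_neg]
    omega
  rw [edgeSum_insertBit 0]
  simp only [same, cross, edgeSum_abs_gray_sub]
  have hmin : ∀ b (w : Fin l → Bool),
      min (2 * (gray (l + 1) (insertBit 0 b w) : ℤ) - 1)
        (2 * 2 ^ (l + 1) + 1 - 2 * gray (l + 1) (insertBit 0 b w)) =
      2 * gray l w - 1 := by
    intro b w
    have hw := bound _ w
    cases b <;> simp only [gray_insertBit_false, natCast_gray_insertBit_true] <;> omega
  have hS := sum_gray l
  rw [← Finset.mul_sum, sum_insertBit 0]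
  simp only [hmin, Finset.sum_sub_distrib, ← Finset.mul_sum, hS, Finset.sum_const,
    Finset.card_univ, Fintype.card_pi, Fintype.card_bool, Finset.prod_const, Fintype.card_fin,
    nsmul_eq_mul]
  push_cast
  ring

lemma edgeSum_cycDist_gray_eq {a : ℕ} (ha : 2 ≤ a) :
    edgeSum (fun u v => cycDist (2 ^ a) (gray a u) (gray a v)) =
      2 * (3 * 2 ^ (2 * a - 3) - 2 ^ (a - 1)) := by
  zify
  rw [natCast_cycle_wirelength ha, edgeSum_natCast]
  obtain ⟨l, rfl⟩ := Nat.exists_eq_add_of_le' ha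
  rw [edgeSum_cycDist_gray, Nat.add_sub_cancel]
  ring

lemma diffCount_append {m n : ℕ} (u₁ v₁ : Fin m → Bool) (u₂ v₂ : Fin n → Bool) :
    diffCount (Fin.append u₁ u₂) (Fin.append v₁ v₂) = diffCount u₁ v₁ + diffCount u₂ v₂ := by
  simp only [diffCount_eq_sum, Fin.sum_univ_add, Fin.append_left, Fin.append_right]

lemma sum_append {m n : ℕ} (F : (Fin (m + n) → Bool) → ℕ) :
    ∑ w, F w = ∑ u₁, ∑ u₂, F (Fin.append u₁ u₂) := by
  rw [← Equiv.sum_comp (Fin.appendEquiv m n), Fintype.sum_prod_type]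
  rfl

lemma cubeAdj_append {m n : ℕ} {u₁ v₁ : Fin m → Bool} {u₂ v₂ : Fin n → Bool} :
    cubeAdj (Fin.append u₁ u₂) (Fin.append v₁ v₂) ↔ diffCount u₁ v₁ + diffCount u₂ v₂ = 1 := by
  rw [cubeAdj, diffCount_append]

lemma cubeAdj_append_ite {m n : ℕ} (u₁ v₁ : Fin m → Bool) (u₂ v₂ : Fin n → Bool) {x : ℕ}
    (hx : u₁ = v₁ → x = 0) :
    (if cubeAdj (Fin.append u₁ u₂) (Fin.append v₁ v₂) then x else 0) =
      if u₂ = v₂ then if cubeAdj u₁ v₁ then x else 0 else 0 := by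
  simp only [cubeAdj_append]
  by_cases h : u₂ = v₂
  · rw [if_pos h, diffCount_eq_zero.mpr h, add_zero]
    rfl
  · rw [if_neg h]
    split_ifs with h'
    · have := mt diffCount_eq_zero.mp h
      exact hx (diffCount_eq_zero.mp (by omega))
    · rfl

lemma cubeAdj_append_comm {m n : ℕ} (u₁ v₁ : Fin m → Bool) (u₂ v₂ : Fin n → Bool) :
    cubeAdj (Fin.append u₁ u₂) (Fin.append v₁ v₂) ↔
      cubeAdj (Fin.append u₂ u₁) (Fin.append v₂ v₁) := by
  rw [cubeAdj_append, cubeAdj_append, add_comm]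

lemma edgeSum_castAdd {m n : ℕ} {c : (Fin m → Bool) → (Fin m → Bool) → ℕ}
    (hc : ∀ u, c u u = 0) :
    edgeSum (fun u v : Fin (m + n) → Bool =>
      c (fun i => u (Fin.castAdd n i)) fun i => v (Fin.castAdd n i)) = 2 ^ n * edgeSum c := by
  simp only [edgeSum, sum_append, Fin.append_left, Finset.mul_sum]
  refine Finset.sum_congr rfl fun u₁ _ => ?_
  rw [Finset.sum_comm]
  refine Finset.sum_congr rfl fun v₁ _ => ?_
  have h : u₁ = v₁ → c u₁ v₁ = 0 := fun h => h ▸ hc u₁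
  simp [cubeAdj_append_ite _ _ _ _ h]

lemma edgeSum_natAdd {m n : ℕ} {c : (Fin n → Bool) → (Fin n → Bool) → ℕ}
    (hc : ∀ u, c u u = 0) :
    edgeSum (fun u v : Fin (m + n) → Bool =>
      c (fun i => u (Fin.natAdd m i)) fun i => v (Fin.natAdd m i)) = 2 ^ m * edgeSum c := by
  rw [← edgeSum_castAdd hc]
  simp only [edgeSum, sum_append, Fin.append_left, Fin.append_right]
  rw [Finset.sum_comm]
  refine Finset.sum_congr rfl fun u₂ _ => Finset.sum_congr rfl fun u₁ _ => ?_
  rw [Finset.sum_comm]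
  refine Finset.sum_congr rfl fun v₂ _ => Finset.sum_congr rfl fun v₁ _ => ?_
  simp only [cubeAdj_append_comm u₁]

lemma gray2_bijOn (n₁ n₂ : ℕ) :
    Set.BijOn (gray2 n₁ n₂) Set.univ ((Set.Icc 1 (2 ^ n₁)) ×ˢ (Set.Icc 1 (2 ^ n₂))) := by
  refine ⟨fun v _ => ⟨gray_mem_Icc _ _, gray_mem_Icc _ _⟩, fun u _ v _ h => ?_, ?_⟩
  · have h₁ := gray_injective _ (congrArg Prod.fst h)
    have h₂ := gray_injective _ (congrArg Prod.snd h)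
    funext i
    exact Fin.addCases (fun i => congrFun h₁ i) (fun i => congrFun h₂ i) i
  · rintro ⟨y₁, y₂⟩ ⟨hy₁, hy₂⟩
    obtain ⟨u₁, _, rfl⟩ := (gray_bijOn n₁).surjOn hy₁
    obtain ⟨u₂, _, rfl⟩ := (gray_bijOn n₂).surjOn hy₂
    exact ⟨Fin.append u₁ u₂, Set.mem_univ _, by simp [gray2]⟩

lemma cycDist_self (m a : ℕ) : cycDist m a a = 0 := by
  simp [cycDist, Nat.dist_self]

lemma wirelength_gray2 {n₁ n₂ : ℕ} (h₁ : 2 ≤ n₁) (h₂ : 2 ≤ n₂) :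
    wirelength (torusDist (2 ^ n₁) (2 ^ n₂)) (gray2 n₁ n₂) =
      2 ^ n₂ * (3 * 2 ^ (2 * n₁ - 3) - 2 ^ (n₁ - 1)) +
        2 ^ n₁ * (3 * 2 ^ (2 * n₂ - 3) - 2 ^ (n₂ - 1)) := by
  have e₁ := edgeSum_castAdd (n := n₂)
    (c := fun u v => cycDist (2 ^ n₁) (gray n₁ u) (gray n₁ v)) fun _ => cycDist_self _ _
  have e₂ := edgeSum_natAdd (m := n₁)
    (c := fun u v => cycDist (2 ^ n₂) (gray n₂ u) (gray n₂ v)) fun _ => cycDist_self _ _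
  rw [edgeSum_cycDist_gray_eq h₁] at e₁
  rw [edgeSum_cycDist_gray_eq h₂] at e₂
  have h := congrArg₂ (· + ·) e₁ e₂
  simp only [← edgeSum_add] at h
  refine (congrArg (· / 2) h).trans ?_
  rw [mul_left_comm, mul_left_comm _ 2, ← mul_add, Nat.mul_div_cancel_left _ two_pos]

/-- Minimum wirelength of the hypercube into the torus `C_{2^{n₁}} × C_{2^{n₂}}`,
achieved by the 2-order Gray code embedding. -/
theorem stmt12 (n₁ n₂ : ℕ) (h₁ : 2 ≤ n₁) (h₂ : 2 ≤ n₂) :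
    (∀ f : (Fin (n₁ + n₂) → Bool) → ℕ × ℕ,
      Set.BijOn f Set.univ ((Set.Icc 1 (2 ^ n₁)) ×ˢ (Set.Icc 1 (2 ^ n₂))) →
      2 ^ n₂ * (3 * 2 ^ (2 * n₁ - 3) - 2 ^ (n₁ - 1)) +
          2 ^ n₁ * (3 * 2 ^ (2 * n₂ - 3) - 2 ^ (n₂ - 1)) ≤
        wirelength (torusDist (2 ^ n₁) (2 ^ n₂)) f) ∧
    Set.BijOn (gray2 n₁ n₂) Set.univ ((Set.Icc 1 (2 ^ n₁)) ×ˢ (Set.Icc 1 (2 ^ n₂))) ∧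
    wirelength (torusDist (2 ^ n₁) (2 ^ n₂)) (gray2 n₁ n₂) =
      2 ^ n₂ * (3 * 2 ^ (2 * n₁ - 3) - 2 ^ (n₁ - 1)) +
        2 ^ n₁ * (3 * 2 ^ (2 * n₂ - 3) - 2 ^ (n₂ - 1)) :=
  ⟨fun _ hf => wirelength_torusDist_ge h₁ h₂ hf, gray2_bijOn n₁ n₂, wirelength_gray2 h₁ h₂⟩
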